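/- Let k ≥ 5 be an integer, λ a fixed nonzero real number, and ε > 0. There is a constant C such that for all sufficiently large X and all τ with 0 < τ < 1, ∫_ℝ |S_k(λα)|^{m₁(k)} K_τ(α) dα ≤ C τ X^{m₁(k)/k − 49/50 + ε}. -/

import Mathlib

open MeasureTheory Finset
open scoped Classical

/-- `e(x) = exp(2πix)`. -/
noncomputable def e (x : ℝ) : ℂ := Complex.exp (2 * Real.pi * Complex.I * x)

/-- Fejér-type kernel `K_τ(α)`. -/
noncomputable def Kf (τ α : ℝ) : ℝ :=
  if α = 0 then τ ^ 2 else (Real.sin (Real.pi * τ * α) / (Real.pi * α)) ^ 2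

/-- `ψ(m,z) = 1` if every prime factor of `m` is `≥ z`, else `0`. -/
noncomputable def psi (m : ℕ) (z : ℝ) : ℝ :=
  if ∀ p : ℕ, p.Prime → p ∣ m → z ≤ (p : ℝ) then 1 else 0

/-- `z(p)` in the sieve weights. -/
noncomputable def zP (X : ℝ) (p : ℕ) : ℝ :=
  if (p : ℝ) < X ^ ((1:ℝ)/7) then X ^ ((5:ℝ)/28) * (p : ℝ) ^ (-(1:ℝ)/2)
  else if (p : ℝ) ≤ X ^ ((3:ℝ)/14) then (p : ℝ)
  else X ^ ((5:ℝ)/14) / (p : ℝ)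

/-- The sieve function `ρ(m)` of Harman–Kumchev. -/
noncomputable def rho (X : ℝ) (m : ℕ) : ℝ :=
  psi m (X ^ ((5:ℝ)/42)) -
    ∑ p ∈ m.primeFactors.filter
        (fun p : ℕ => X ^ ((5:ℝ)/42) ≤ (p:ℝ) ∧ (p:ℝ) ≤ X ^ ((1:ℝ)/4)),
      psi (m / p) (zP X p)

/-- `S_k(α) = Σ_{p ∈ [(ηX)^{1/k}, X^{1/k}]} (log p) e(p^k α)`, sum over primes. -/
noncomputable def SS (η X : ℝ) (k : ℕ) (α : ℝ) : ℂ :=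
  ∑ p ∈ (Finset.Icc 1 ⌊X ^ ((1:ℝ)/(k:ℝ))⌋₊).filter
      (fun p : ℕ => p.Prime ∧ (η * X) ^ ((1:ℝ)/(k:ℝ)) ≤ (p : ℝ)),
    (Real.log p : ℂ) * e ((p : ℝ) ^ k * α)

/-- `S₂(α, ρ) = Σ_{m ∈ [(ηX)^{1/2}, X^{1/2}]} ρ(m) e(m²α)`. -/
noncomputable def S2 (η X α : ℝ) : ℂ :=
  ∑ m ∈ (Finset.Icc 1 ⌊X ^ ((1:ℝ)/2)⌋₊).filter
      (fun m : ℕ => (η * X) ^ ((1:ℝ)/2) ≤ (m : ℝ)),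
    (rho X m : ℂ) * e ((m : ℝ) ^ 2 * α)

/-- `S_r(α)` for real `r ≥ 1`. -/
noncomputable def Sr (η X r α : ℝ) : ℂ :=
  ∑ p ∈ (Finset.Icc 1 ⌊X ^ (1/r)⌋₊).filter
      (fun p : ℕ => p.Prime ∧ (η * X) ^ (1/r) ≤ (p : ℝ)),
    (Real.log p : ℂ) * e ((p : ℝ) ^ r * α)

/-- `U_r(α)` for real `r ≥ 1`. -/
noncomputable def Ur (η X r α : ℝ) : ℂ :=
  ∑ n ∈ (Finset.Icc 1 ⌊X ^ (1/r)⌋₊).filter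
      (fun n : ℕ => (η * X) ^ (1/r) ≤ (n : ℝ)),
    e ((n : ℝ) ^ r * α)

/-- Chebyshev's function `θ(x) = Σ_{p ≤ x} log p`. -/
noncomputable def theta (x : ℝ) : ℝ :=
  ∑ p ∈ (Finset.Icc 1 ⌊x⌋₊).filter Nat.Prime, Real.log p

/-- `J_r(X,h)`. -/
noncomputable def J (ε r X h : ℝ) : ℝ :=
  ∫ x in Set.Icc (ε * X) X,
    (theta ((x + h) ^ (1/r)) - theta (x ^ (1/r)) - ((x + h) ^ (1/r) - x ^ (1/r))) ^ 2

/-- `T_n(α) = ∫_{(ηX)^{1/n}}^{X^{1/n}} e(t^n α) dt`. -/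
noncomputable def T (η X : ℝ) (n : ℕ) (α : ℝ) : ℂ :=
  ∫ t in Set.Icc ((η * X) ^ ((1:ℝ)/(n:ℝ))) (X ^ ((1:ℝ)/(n:ℝ))), e (t ^ n * α)

/-- `m₁(k)`. -/
noncomputable def m1 (k : ℕ) : ℝ :=
  if k = 5 then 2 * (⌈343 * (k:ℝ) / 50 - 20⌉ : ℝ)
  else 2 * (⌈(49 * (k:ℝ) / 50 - (⌊49 * (k:ℝ) / 50⌋ : ℝ) / 2)
      * ((⌊49 * (k:ℝ) / 50⌋ : ℝ) + 1)⌉ : ℝ)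

/-- `σ(k) = 44/45 − 24/(25 m₁(k))`. -/
noncomputable def sigma' (k : ℕ) : ℝ := 44/45 - 24 / (25 * m1 k)

/-- `m(k)` depending on `δ`. -/
noncomputable def mδ (k : ℕ) (δ : ℝ) : ℝ :=
  if ⌊(k:ℝ) * δ⌋ ≤ 3 then
    2 * (⌈((k:ℝ) * δ + 1 - (⌊(k:ℝ) * δ⌋ : ℝ)) * (2:ℝ) ^ (⌊(k:ℝ) * δ - 1⌋)⌉ : ℝ)
  else if ⌊(k:ℝ) * δ⌋ = 4 then 2 * (⌈7 * (k:ℝ) * δ - 20⌉ : ℝ)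
  else 2 * (⌈((k:ℝ) * δ - (⌊(k:ℝ) * δ⌋ : ℝ)/2) * ((⌊(k:ℝ) * δ⌋ : ℝ) + 1)⌉ : ℝ)

/-- `m₂(k)`. -/
noncomputable def m2 (k : ℕ) : ℝ :=
  if k = 5 then
    2 * (⌈(2 * (k:ℝ)/3 + 1 - (⌊2 * (k:ℝ)/3⌋ : ℝ)) * (2:ℝ) ^ (⌊2 * (k:ℝ)/3⌋ - 1)⌉ : ℝ)
  else if k ≤ 7 then 2 * (⌈14 * (k:ℝ)/3 - 20⌉ : ℝ)
  else 2 * (⌈(2 * (k:ℝ)/3 - (⌊2 * (k:ℝ)/3⌋ : ℝ)/2) * ((⌊2 * (k:ℝ)/3⌋ : ℝ) + 1)⌉ : ℝ)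

open MeasureTheory Finset
open scoped Classical

namespace VM

/-- `L^Q` power sum. -/
noncomputable def LN {Ω : Type} [Fintype Ω] (f : ℤ → Ω → ℂ) (Q : ℕ) (S : Finset ℤ) : ℝ :=
  ∑ ω, ‖∑ x ∈ S, f x ω‖ ^ Q

/-- residue class -/
noncomputable def cls (γ : ℤ → ℤ) (q : ℕ) (r : ℕ) (S : Finset ℤ) : Finset ℤ :=
  S.filter (fun x => γ x % (q : ℤ) = (r : ℤ))

noncomputable def En {Ω : Type} [Fintype Ω] (γ : ℤ → ℤ) (f : ℤ → Ω → ℂ) (Q q : ℕ)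
    (S : Finset ℤ) : ℝ :=
  ∑ r ∈ range q, LN f Q (cls γ q r S)

def Modul {Ω : Type} {d : ℕ} (S : Finset ℤ) (f : ℤ → Ω → ℂ) (q : ℕ) (v : ℤ → Fin d → ℤ) : Prop :=
  ∀ h : Fin d → ℤ, ∃ T : Equiv.Perm Ω, ∀ ω, ∃ c : ℂ, ‖c‖ = 1 ∧
    ∀ x ∈ S, f x (T ω) = c * e (((∑ i, h i * v x i : ℤ) : ℝ) / (q : ℝ)) * f x ω

lemma LN_nonneg {Ω : Type} [Fintype Ω] (f : ℤ → Ω → ℂ) (Q : ℕ) (S : Finset ℤ) :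
    0 ≤ LN f Q S := sum_nonneg fun _ _ => by positivity

lemma En_nonneg {Ω : Type} [Fintype Ω] (γ : ℤ → ℤ) (f : ℤ → Ω → ℂ) (Q q : ℕ)
    (S : Finset ℤ) : 0 ≤ En γ f Q q S := sum_nonneg fun _ _ => LN_nonneg _ _ _

lemma LN_empty {Ω : Type} [Fintype Ω] (f : ℤ → Ω → ℂ) {Q : ℕ} (hQ : Q ≠ 0) :
    LN f Q ∅ = 0 := by simp [LN, hQ]

lemma e_add (x y : ℝ) : e (x + y) = e x * e y := by
  unfold e; rw [← Complex.exp_add]; congr 1; push_cast; ring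

lemma e_int (m : ℤ) : e (m : ℝ) = 1 := by
  unfold e
  rw [Complex.exp_eq_one_iff]
  exact ⟨m, by push_cast; ring⟩

lemma norm_e (x : ℝ) : ‖e x‖ = 1 := by
  unfold e
  rw [show (2 * Real.pi * Complex.I * x : ℂ) = ((2 * Real.pi * x : ℝ) : ℂ) * Complex.I by
    push_cast; ring]
  exact Complex.norm_exp_ofReal_mul_I _

lemma Modul.mono {Ω : Type} {d : ℕ} {S S' : Finset ℤ} {f : ℤ → Ω → ℂ} {q : ℕ}
    {v : ℤ → Fin d → ℤ} (h : Modul S f q v) (hS : S' ⊆ S) : Modul S' f q v := by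
  intro w
  obtain ⟨T, hT⟩ := h w
  refine ⟨T, fun ω => ?_⟩
  obtain ⟨c, hc, h2⟩ := hT ω
  exact ⟨c, hc, fun x hx => h2 x (hS hx)⟩

lemma Modul.change {Ω : Type} {d d' : ℕ} {S : Finset ℤ} {f : ℤ → Ω → ℂ} {q q' : ℕ}
    {v : ℤ → Fin d → ℤ} {v' : ℤ → Fin d' → ℤ} (h : Modul S f q v)
    (H : ∀ h' : Fin d' → ℤ, ∃ h : Fin d → ℤ, ∃ r : ℝ, ∀ x ∈ S,
      ((∑ i, h i * v x i : ℤ) : ℝ) / (q : ℝ) = r + ((∑ i, h' i * v' x i : ℤ) : ℝ) / (q' : ℝ)) :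
    Modul S f q' v' := by
  intro h'
  obtain ⟨h1, r, hr⟩ := H h'
  obtain ⟨T, hT⟩ := h h1
  refine ⟨T, fun ω => ?_⟩
  obtain ⟨c, hc, h2⟩ := hT ω
  refine ⟨c * e r, by rw [norm_mul, hc, norm_e, one_mul], fun x hx => ?_⟩
  rw [h2 x hx, hr x hx, e_add]; ring

/-- Hölder -/
lemma holder {ι : Type*} (s : Finset ι) (U V : ι → ℝ) (hU : ∀ i ∈ s, 0 ≤ U i)
    (hV : ∀ i ∈ s, 0 ≤ V i) {t : ℝ} (h0 : 0 < t) (h1 : t < 1) :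
    ∑ i ∈ s, U i ^ t * V i ^ (1 - t) ≤ (∑ i ∈ s, U i) ^ t * (∑ i ∈ s, V i) ^ (1 - t) := by
  have hc : (1 / t).HolderConjugate (1 / (1 - t)) := by
    rw [Real.holderConjugate_iff]
    refine ⟨by rw [lt_div_iff₀ h0]; linarith, ?_⟩
    simp
  have := Real.inner_le_Lp_mul_Lq_of_nonneg s (f := fun i => U i ^ t) (g := fun i => V i ^ (1 - t))
    hc (fun i hi => Real.rpow_nonneg (hU i hi) _) (fun i hi => Real.rpow_nonneg (hV i hi) _)
  refine this.trans (le_of_eq ?_)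
  have h1' : 0 < 1 - t := by linarith
  congr 1
  · rw [one_div_one_div]; congr 1
    refine sum_congr rfl fun i hi => ?_
    rw [← Real.rpow_mul (hU i hi), mul_one_div_cancel h0.ne', Real.rpow_one]
  · rw [one_div_one_div]; congr 1
    refine sum_congr rfl fun i hi => ?_
    rw [← Real.rpow_mul (hV i hi), mul_one_div_cancel h1'.ne', Real.rpow_one]

lemma holder_card {ι : Type*} (s : Finset ι) (U : ι → ℝ) (hU : ∀ i ∈ s, 0 ≤ U i)
    {t : ℝ} (h0 : 0 < t) (h1 : t < 1) :
    ∑ i ∈ s, U i ^ t ≤ (∑ i ∈ s, U i) ^ t * (s.card : ℝ) ^ (1 - t) := by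
  have := holder s U (fun _ => 1) hU (fun _ _ => zero_le_one) h0 h1
  simpa using this

/-- partition refinement -/
lemma En_refine {Ω : Type} [Fintype Ω] (γ : ℤ → ℤ) (f : ℤ → Ω → ℂ) {Q : ℕ} (hQ : Q ≠ 0) (q : ℕ)
    (S : Finset ℤ) (κ : ℤ → ℤ) (m N : ℕ)
    (hκ : ∀ x ∈ S, ∀ y ∈ S, γ x % (q : ℤ) = γ y % (q : ℤ) → κ x % (m : ℤ) = κ y % (m : ℤ)) :
    ∑ r ∈ range N, En γ f Q q (cls κ m r S) ≤ En γ f Q q S := by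
  unfold En
  rw [sum_comm]
  refine sum_le_sum fun R _ => ?_
  by_cases hne : (cls γ q R S).Nonempty
  · obtain ⟨x, hx⟩ := hne
    have hx' := hx
    simp only [cls, mem_filter] at hx'
    have key : ∀ r : ℕ, (r : ℤ) ≠ κ x % (m : ℤ) → LN f Q (cls γ q R (cls κ m r S)) = 0 := by
      intro r hr
      have : cls γ q R (cls κ m r S) = ∅ := by
        apply Finset.eq_empty_of_forall_notMem
        intro y hy
        simp only [cls, mem_filter] at hy
        exact hr (by rw [← hy.1.2]; exact hκ y hy.1.1 x hx'.1 (by rw [hy.2, hx'.2]))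
      rw [this, LN_empty f hQ]
    by_cases hr0 : ∃ r0 ∈ range N, (r0 : ℤ) = κ x % (m : ℤ)
    · obtain ⟨r0, hr0, hr1⟩ := hr0
      rw [sum_eq_single_of_mem r0 hr0]
      · have : cls γ q R (cls κ m r0 S) = cls γ q R S := by
          ext y
          simp only [cls, mem_filter]
          constructor
          · rintro ⟨⟨h1, h2⟩, h3⟩; exact ⟨h1, h3⟩
          · rintro ⟨h1, h3⟩
            exact ⟨⟨h1, by rw [hr1]; exact hκ y h1 x hx'.1 (by rw [h3, hx'.2])⟩, h3⟩
        rw [this]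
      · intro r _ hr
        exact key r (by rw [← hr1]; exact_mod_cast hr)
    · rw [sum_eq_zero]
      · exact LN_nonneg _ _ _
      · intro r hr
        exact key r (fun h => hr0 ⟨r, hr, h⟩)
  · rw [sum_eq_zero]
    · exact LN_nonneg _ _ _
    · intro r _
      have : cls γ q R (cls κ m r S) = ∅ := by
        apply Finset.eq_empty_of_forall_notMem
        intro y hy
        simp only [cls, mem_filter] at hy
        exact hne ⟨y, by simp only [cls, mem_filter]; exact ⟨hy.1.1, hy.2⟩⟩
      rw [this, LN_empty f hQ]

lemma En_mono_sub {Ω : Type} [Fintype Ω] (γ : ℤ → ℤ) (f : ℤ → Ω → ℂ) {Q : ℕ} (hQ : Q ≠ 0) (q : ℕ)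
    (S : Finset ℤ) (κ : ℤ → ℤ) (m N r : ℕ) (hr : r < N)
    (hκ : ∀ x ∈ S, ∀ y ∈ S, γ x % (q : ℤ) = γ y % (q : ℤ) → κ x % (m : ℤ) = κ y % (m : ℤ)) :
    En γ f Q q (cls κ m r S) ≤ En γ f Q q S :=
  (single_le_sum (f := fun r => En γ f Q q (cls κ m r S)) (fun _ _ => En_nonneg _ _ _ _ _)
    (mem_range.2 hr)).trans (En_refine γ f hQ q S κ m N hκ)

/-- sum over classes -/
lemma sum_cls {M : Type*} [AddCommMonoid M] (γ : ℤ → ℤ) (q : ℕ) (hq : 0 < q) (S : Finset ℤ)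
    (g : ℤ → M) : ∑ r ∈ range q, ∑ x ∈ cls γ q r S, g x = ∑ x ∈ S, g x := by
  have hq' : (0 : ℤ) < q := by exact_mod_cast hq
  unfold cls
  have := sum_fiberwise_of_maps_to (s := S) (t := range q) (g := fun x => (γ x % (q : ℤ)).toNat)
    (fun x _ => by
      rw [mem_range]
      have h1 := Int.emod_lt_of_pos (γ x) hq'
      have h2 := Int.emod_nonneg (γ x) hq'.ne'
      omega) g
  rw [← this]
  refine sum_congr rfl fun r _ => ?_
  refine sum_congr ?_ fun _ _ => rfl
  ext x
  simp only [mem_filter]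
  have h2 := Int.emod_nonneg (γ x) hq'.ne'
  constructor
  · rintro ⟨h, h'⟩; exact ⟨h, by omega⟩
  · rintro ⟨h, h'⟩; exact ⟨h, by omega⟩

/-- trivial decoupling, pointwise -/
lemma triv_pt {Ω : Type} (γ : ℤ → ℤ) (f : ℤ → Ω → ℂ) (Q : ℕ) (hQ : Q ≠ 0) (q : ℕ) (hq : 0 < q)
    (S : Finset ℤ) (ω : Ω) :
    ‖∑ x ∈ S, f x ω‖ ^ Q ≤ (q : ℝ) ^ (Q - 1) * ∑ r ∈ range q, ‖∑ x ∈ cls γ q r S, f x ω‖ ^ Q := by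
  obtain ⟨n, rfl⟩ := Nat.exists_eq_succ_of_ne_zero hQ
  rw [← sum_cls γ q hq S]
  calc _ ≤ (∑ r ∈ range q, ‖∑ x ∈ cls γ q r S, f x ω‖) ^ (n + 1) := by
        gcongr; exact norm_sum_le _ _
    _ ≤ _ := by
        have := pow_sum_le_card_mul_sum_pow (s := range q)
          (f := fun r => ‖∑ x ∈ cls γ q r S, f x ω‖) (fun _ _ => norm_nonneg _) n
        simpa using this

lemma triv_LN {Ω : Type} [Fintype Ω] (γ : ℤ → ℤ) (f : ℤ → Ω → ℂ) (Q : ℕ) (hQ : Q ≠ 0) (q : ℕ)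
    (hq : 0 < q) (S : Finset ℤ) : LN f Q S ≤ (q : ℝ) ^ (Q - 1) * En γ f Q q S := by
  unfold En LN
  rw [sum_comm, mul_sum]
  exact sum_le_sum fun ω _ => triv_pt γ f Q hQ q hq S ω

end VM

open MeasureTheory Finset
open scoped Classical

namespace VM
open Polynomial in
/-- curves congruent to a multiple of the moment curve mod `p` -/
def Good (p d : ℕ) (φ : Fin d → ℤ[X]) : Prop :=
  ∃ u : ZMod p, u ≠ 0 ∧ ∀ i : Fin d,
    (φ i).map (Int.castRingHom (ZMod p)) = C u * X ^ ((i : ℕ) + 1)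

/-- decoupling with constant `K` -/
def Dec (p d n : ℕ) (K : ℝ) : Prop :=
  ∀ (Ω : Type) [Fintype Ω] (S : Finset ℤ) (γ : ℤ → ℤ) (f : ℤ → Ω → ℂ)
    (φ : Fin d → Polynomial ℤ), Good p d φ →
    Modul S f (p ^ (d * n)) (fun x i => (φ i).eval (γ x)) →
    LN f (d * (d + 1)) S ≤ K * (p : ℝ) ^ (n * (d * (d + 1) / 2 - 1)) *
      En γ f (d * (d + 1)) (p ^ n) S

section poly
open Polynomial

noncomputable def Wr {l : ℕ} (ρ : Fin l → ℤ[X]) (x0 : ℤ) : Matrix (Fin l) (Fin l) ℤ :=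
  fun i j => (taylor x0 (ρ i)).coeff ((j : ℕ) + 1)

noncomputable def recn {l : ℕ} (ρ : Fin l → ℤ[X]) (x0 : ℤ) (j : Fin l) : ℤ[X] :=
  ∑ i, C ((Wr ρ x0).adjugate j i) * (taylor x0 (ρ i) - C ((ρ i).eval x0))

lemma recn_eval {l : ℕ} (ρ : Fin l → ℤ[X]) (x0 : ℤ) (j : Fin l) (y : ℤ) :
    (recn ρ x0 j).eval y =
      ∑ i, (Wr ρ x0).adjugate j i * ((ρ i).eval (y + x0) - (ρ i).eval x0) := by
  simp [recn, eval_finsetSum, taylor_eval]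

lemma recn_coeff_zero {l : ℕ} (ρ : Fin l → ℤ[X]) (x0 : ℤ) (j : Fin l) :
    (recn ρ x0 j).coeff 0 = 0 := by
  rw [coeff_zero_eq_eval_zero, recn_eval]; simp

lemma recn_coeff_succ {l : ℕ} (ρ : Fin l → ℤ[X]) (x0 : ℤ) (j m : Fin l) :
    (recn ρ x0 j).coeff ((m : ℕ) + 1) = if j = m then (Wr ρ x0).det else 0 := by
  have h := congrFun (congrFun (Matrix.adjugate_mul (Wr ρ x0)) j) m
  rw [Matrix.mul_apply] at h
  simp only [Matrix.smul_apply, Matrix.one_apply, smul_eq_mul, mul_ite, mul_one, mul_zero] at h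
  rw [← h]
  simp only [recn, finsetSum_coeff, coeff_C_mul, coeff_sub, coeff_C_succ, sub_zero]
  rfl

lemma recn_dvd {l : ℕ} (ρ : Fin l → ℤ[X]) (x0 : ℤ) (j : Fin l) :
    X ^ ((j : ℕ) + 1) ∣ recn ρ x0 j := by
  rw [X_pow_dvd_iff]
  intro m hm
  rcases m with _ | m
  · exact recn_coeff_zero ρ x0 j
  · have := recn_coeff_succ ρ x0 j ⟨m, by omega⟩
    simp only at this
    rw [this, if_neg]
    intro h; rw [h] at hm; simp at hm

lemma recn_dvd2 {l : ℕ} (ρ : Fin l → ℤ[X]) (x0 : ℤ) (j : Fin l) :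
    X ^ (l + 1) ∣ recn ρ x0 j - C (Wr ρ x0).det * X ^ ((j : ℕ) + 1) := by
  rw [X_pow_dvd_iff]
  intro m hm
  rcases m with _ | m
  · simp [recn_coeff_zero ρ x0 j]
  · have := recn_coeff_succ ρ x0 j ⟨m, by omega⟩
    simp only at this
    rw [coeff_sub, this, coeff_C_mul, coeff_X_pow]
    by_cases h : j = ⟨m, by omega⟩
    · have hj : (j : ℕ) = m := by rw [h]
      rw [if_pos h, if_pos (by omega)]; ring
    · rw [if_neg h, if_neg]
      · simp
      · intro h'; exact h (Fin.ext (by simp; omega))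

lemma rescale_poly {p : ℕ} {l : ℕ} (ρ : Fin l → ℤ[X]) (x0 : ℤ)
    (hdet : ¬ (p : ℤ) ∣ (Wr ρ x0).det) {a : ℕ} (ha : 1 ≤ a) :
    ∃ χ : Fin l → ℤ[X], Good p l χ ∧ ∀ j : Fin l, ∀ g : ℤ,
      (recn ρ x0 j).eval ((p : ℤ) ^ a * g) = (p : ℤ) ^ (a * ((j : ℕ) + 1)) * (χ j).eval g := by
  choose ψ hψ using fun j => recn_dvd2 ρ x0 j
  refine ⟨fun j => C (Wr ρ x0).det * X ^ ((j : ℕ) + 1) +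
    C ((p : ℤ) ^ (a * (l - j))) * (X ^ (l + 1) * (ψ j).comp (C ((p : ℤ) ^ a) * X)), ?_, ?_⟩
  · refine ⟨((Wr ρ x0).det : ZMod p), ?_, ?_⟩
    · rw [Ne, ZMod.intCast_zmod_eq_zero_iff_dvd]; exact hdet
    · intro i
      have h1 : a * (l - (i : ℕ)) ≠ 0 := by
        have := i.2
        have : 0 < l - (i : ℕ) := by omega
        positivity
      simp [Polynomial.map_add, Polynomial.map_mul, h1]
  · intro j g
    have h := congrArg (Polynomial.eval ((p : ℤ) ^ a * g)) (hψ j)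
    simp only [eval_sub, eval_mul, eval_C, eval_pow, eval_X] at h
    simp only [eval_add, eval_mul, eval_C, eval_pow, eval_X, eval_comp]
    have h2 : l + 1 = ((j : ℕ) + 1) + (l - j) := by have := j.2; omega
    have h3 : ((p : ℤ) ^ a) ^ (l + 1) = (p : ℤ) ^ (a * ((j : ℕ) + 1)) * (p : ℤ) ^ (a * (l - j)) := by
      rw [← pow_mul, ← pow_add, ← Nat.mul_add, ← h2]
    rw [sub_eq_iff_eq_add] at h
    rw [h, mul_pow _ g, h3, mul_pow, ← pow_mul]
    ring

lemma det_good {p : ℕ} [Fact p.Prime] {l : ℕ} (m : ℕ) (hml : m + l < p) (ρ : Fin l → ℤ[X])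
    (x0 : ℤ) (u : ZMod p) (hu : u ≠ 0)
    (hρ : ∀ i : Fin l, (ρ i).map (Int.castRingHom (ZMod p)) = C u * X ^ (m + (i : ℕ) + 1))
    (hx : m = 0 ∨ ¬ (p : ℤ) ∣ x0) : ¬ (p : ℤ) ∣ (Wr ρ x0).det := by
  intro hdvd
  have hdet : ((Wr ρ x0).map (Int.castRingHom (ZMod p))).det = 0 := by
    have := RingHom.map_det (Int.castRingHom (ZMod p)) (Wr ρ x0)
    rw [RingHom.mapMatrix_apply] at this
    rw [← this]
    simpa using (ZMod.intCast_zmod_eq_zero_iff_dvd _ p).2 hdvd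
  obtain ⟨v, hv, hvM⟩ := Matrix.exists_vecMul_eq_zero_iff.2 hdet
  set y : ZMod p := (x0 : ZMod p) with hy
  have hnat : ∀ n : ℕ, 0 < n → n < p → (n : ZMod p) ≠ 0 := by
    intro n h1 h2 h3
    rw [ZMod.natCast_eq_zero_iff] at h3
    exact absurd (Nat.le_of_dvd h1 h3) (by omega)
  let P : (ZMod p)[X] := ∑ i : Fin l, C (v i) * (C u * X ^ (m + (i : ℕ) + 1))
  let R : (ZMod p)[X] := ∑ i : Fin l, C (v i * u * ((m + (i : ℕ) + 1 : ℕ) : ZMod p)) * X ^ (i : ℕ)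
  have hP' : derivative P = X ^ m * R := by
    simp only [P, R, derivative_sum, mul_sum]
    refine sum_congr rfl fun i _ => ?_
    rw [derivative_C_mul, derivative_C_mul, derivative_X_pow]
    simp only [map_mul, add_tsub_cancel_right, pow_add]
    ring
  have hcoef : ∀ j < l, (taylor y P).coeff (j + 1) = 0 := by
    intro j hj
    have h := congrFun hvM ⟨j, hj⟩
    simp only [Matrix.vecMul, dotProduct, Matrix.map_apply, Pi.zero_apply, Wr] at h
    rw [← h]
    simp only [P, map_sum, finsetSum_coeff]
    refine sum_congr rfl fun i _ => ?_
    rw [← hρ i]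
    have ht : (taylor x0 (ρ i)).map (Int.castRingHom (ZMod p)) =
        taylor y ((ρ i).map (Int.castRingHom (ZMod p))) := by
      simp [taylor_apply, Polynomial.map_comp, hy]
    rw [taylor_mul, taylor_C, coeff_C_mul, ← ht, coeff_map]
  have hdiv : X ^ l ∣ derivative (taylor y P) := by
    rw [X_pow_dvd_iff]
    intro j hj
    rw [coeff_derivative, hcoef j hj, zero_mul]
  have hdt : derivative (taylor y P) = (X + C y) ^ m * taylor y R := by
    have : derivative (taylor y P) = taylor y (derivative P) := by
      simp [taylor_apply, derivative_comp]
    rw [this, hP', taylor_mul, taylor_pow, taylor_X]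
  rw [hdt] at hdiv
  have hcop : IsCoprime ((X : (ZMod p)[X]) ^ l) ((X + C y) ^ m) := by
    rcases hx with rfl | hx
    · simp [isCoprime_one_right]
    · apply IsCoprime.pow
      have hy0 : y ≠ 0 := by
        rw [hy, Ne, ZMod.intCast_zmod_eq_zero_iff_dvd]; exact hx
      refine ⟨-C y⁻¹, C y⁻¹, ?_⟩
      have : C y⁻¹ * C y = (1 : (ZMod p)[X]) := by
        rw [← C_mul, inv_mul_cancel₀ hy0, C_1]
      linear_combination this
  have hdR : X ^ l ∣ taylor y R := hcop.dvd_of_dvd_mul_left hdiv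
  have hRcoef : ∀ i : Fin l, R.coeff i = v i * u * ((m + (i : ℕ) + 1 : ℕ) : ZMod p) := by
    intro i
    simp only [R, finsetSum_coeff, coeff_C_mul, coeff_X_pow]
    rw [sum_eq_single i]
    · simp
    · intro b _ hb
      rw [if_neg (fun h => hb (Fin.ext h.symm)), mul_zero]
    · simp
  have hR0 : R = 0 := by
    by_contra hR
    have hdeg : (taylor y R).degree < (X ^ l : (ZMod p)[X]).degree := by
      rw [degree_taylor, degree_X_pow]
      exact degree_sum_fin_lt (fun i : Fin l => v i * u * ((m + (i : ℕ) + 1 : ℕ) : ZMod p))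
    have := eq_zero_of_dvd_of_degree_lt hdR hdeg
    exact hR ((taylor_injective y) (by rw [this, map_zero]))
  apply hv
  funext i
  have h1 := hRcoef i
  rw [hR0, coeff_zero] at h1
  have h2 := hnat (m + (i : ℕ) + 1) (by omega) (by have := i.2; omega)
  rcases mul_eq_zero.1 h1.symm with h | h
  · rcases mul_eq_zero.1 h with h | h
    · exact h
    · exact absurd h hu
  · exact absurd h h2

end poly

lemma Modul.recn {Ω : Type} {l : ℕ} {S : Finset ℤ} {f : ℤ → Ω → ℂ} {q : ℕ}
    (ρ : Fin l → Polynomial ℤ) (x0 : ℤ) (γ : ℤ → ℤ)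
    (h : Modul S f q (fun x i => (ρ i).eval (γ x))) :
    Modul S f q (fun x i => (recn ρ x0 i).eval (γ x - x0)) := by
  refine h.change fun h' => ?_
  refine ⟨fun i => ∑ j, h' j * (Wr ρ x0).adjugate j i,
    ((∑ j, h' j * ∑ i, (Wr ρ x0).adjugate j i * (ρ i).eval x0 : ℤ) : ℝ) / q, fun x _ => ?_⟩
  rw [← add_div, ← Int.cast_add]
  congr 2
  simp only [recn_eval, sub_add_cancel, mul_sub, sum_sub_distrib,
    add_sub_cancel, sum_mul, mul_sum]
  rw [sum_comm]
  refine sum_congr rfl fun i _ => sum_congr rfl fun j _ => by ring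

/-- rescaled decoupling -/
lemma resc {p l n' : ℕ} (hp : 0 < p) {K : ℝ} (hD : Dec p l n' K) (ρ : Fin l → Polynomial ℤ) (x0 : ℤ)
    (hdet : ¬ (p : ℤ) ∣ (Wr ρ x0).det) {a : ℕ} (ha : 1 ≤ a) {B : ℕ} (hB : l * (n' + a) ≤ B)
    {Ω : Type} [Fintype Ω] (S : Finset ℤ) (γ γ' : ℤ → ℤ) (f : ℤ → Ω → ℂ)
    (hγ : ∀ x ∈ S, γ x = x0 + (p : ℤ) ^ a * γ' x)
    (hM : Modul S f (p ^ B) (fun x i => (ρ i).eval (γ x))) :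
    LN f (l * (l + 1)) S ≤ K * (p : ℝ) ^ (n' * (l * (l + 1) / 2 - 1)) *
      En γ' f (l * (l + 1)) (p ^ n') S := by
  obtain ⟨χ, hχ, hχ2⟩ := rescale_poly (p := p) ρ x0 hdet ha
  refine hD Ω S γ' f χ hχ ?_
  refine (hM.recn ρ x0 γ).change fun h' => ?_
  refine ⟨fun j => h' j * (p : ℤ) ^ (B - l * n' - a * ((j : ℕ) + 1)), 0, fun x hx => ?_⟩
  have hp' : (p : ℝ) ≠ 0 := by positivity
  rw [zero_add, div_eq_div_iff (by positivity) (by positivity)]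
  push_cast
  rw [sum_mul, sum_mul]
  refine sum_congr rfl fun j _ => ?_
  rw [show γ x - x0 = (p : ℤ) ^ a * γ' x by rw [hγ x hx]; ring, hχ2 j]
  push_cast
  have hj : a * ((j : ℕ) + 1) ≤ a * l := Nat.mul_le_mul_left _ j.2
  have hB' : l * n' + a * l ≤ B := by linarith [hB, Nat.mul_add l n' a, mul_comm a l]
  have : (p : ℝ) ^ B = (p : ℝ) ^ (B - l * n' - a * ((j : ℕ) + 1)) * (p : ℝ) ^ (a * ((j : ℕ) + 1))
      * (p : ℝ) ^ (l * n') := by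
    rw [← pow_add, ← pow_add]; congr 1; omega
  rw [this]; ring

end VM

open MeasureTheory Finset
open scoped Classical

namespace VM

noncomputable def Mn (p d n a : ℕ) {Ω : Type} [Fintype Ω] (γ : ℤ → ℤ) (f : ℤ → Ω → ℂ)
    (I : Finset ℤ) : ℝ :=
  (p : ℝ) ^ ((n - a) * (d * (d + 1) / 2 - 1)) * En γ f (d * (d + 1)) (p ^ n) I

lemma Mn_nonneg (p d n a : ℕ) {Ω : Type} [Fintype Ω] (γ : ℤ → ℤ) (f : ℤ → Ω → ℂ)
    (I : Finset ℤ) : 0 ≤ Mn p d n a γ f I :=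
  mul_nonneg (by positivity) (En_nonneg _ _ _ _ _)

def Bil (p d l a b n : ℕ) (K : ℝ) : Prop :=
  ∀ (Ω : Type) [Fintype Ω] (I J : Finset ℤ) (γ : ℤ → ℤ) (f : ℤ → Ω → ℂ)
    (φ : Fin d → Polynomial ℤ), Good p d φ →
    Modul (I ∪ J) f (p ^ (d * n)) (fun x i => (φ i).eval (γ x)) →
    ∀ x0 y0 : ℤ, ¬ (p : ℤ) ∣ x0 - y0 →
    (∀ x ∈ I, (p : ℤ) ^ a ∣ γ x - x0) → (∀ x ∈ J, (p : ℤ) ^ b ∣ γ x - y0) →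
    ∑ ω, ‖∑ x ∈ I, f x ω‖ ^ (l * (l + 1)) * ‖∑ x ∈ J, f x ω‖ ^ (d * (d + 1) - l * (l + 1)) ≤
      K * (Mn p d n a γ f I ^ (((l * (l + 1) : ℕ) : ℝ) / ((d * (d + 1) : ℕ) : ℝ)) *
       Mn p d n b γ f J ^ (1 - ((l * (l + 1) : ℕ) : ℝ) / ((d * (d + 1) : ℕ) : ℝ)))

lemma Dec.mono {p d n : ℕ} {K K' : ℝ} (h : Dec p d n K) (hK : K ≤ K') : Dec p d n K' := by
  intro Ω _ S γ f φ hφ hM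
  refine (h Ω S γ f φ hφ hM).trans ?_
  have := En_nonneg γ f (d * (d + 1)) (p ^ n) S
  gcongr

lemma Bil.mono {p d l a b n : ℕ} {K K' : ℝ} (h : Bil p d l a b n K) (hK : K ≤ K') :
    Bil p d l a b n K' := by
  intro Ω _ I J γ f φ hφ hM x0 y0 hxy hI hJ
  refine (h Ω I J γ f φ hφ hM x0 y0 hxy hI hJ).trans ?_
  have h1 := Mn_nonneg p d n a γ f I
  have h2 := Mn_nonneg p d n b γ f J
  gcongr

lemma En_param {Ω : Type} [Fintype Ω] (γ γ' : ℤ → ℤ) (f : ℤ → Ω → ℂ) (Q q m : ℕ) (hq : 0 < q)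
    (hm : 0 < m) (x0 : ℤ) (S : Finset ℤ) (hγ : ∀ x ∈ S, γ x = x0 + (m : ℤ) * γ' x) :
    En γ' f Q q S ≤ En γ f Q (m * q) S := by
  have hq' : (0 : ℤ) < q := by exact_mod_cast hq
  have hm' : (0 : ℤ) < m := by exact_mod_cast hm
  have hmq : (0 : ℤ) < (m : ℤ) * q := by positivity
  let j : ℕ → ℕ := fun r => ((x0 + (m : ℤ) * r) % ((m : ℤ) * q)).toNat
  have hj : ∀ r, ((j r : ℕ) : ℤ) = (x0 + (m : ℤ) * r) % ((m : ℤ) * q) := fun r =>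
    Int.toNat_of_nonneg (Int.emod_nonneg _ hmq.ne')
  have key : ∀ g : ℤ, ∀ r : ℕ, (x0 + (m : ℤ) * g) % ((m : ℤ) * q) = j r ↔ g % q = (r : ℤ) % q := by
    intro g r
    rw [hj]
    change (x0 + (m : ℤ) * g) ≡ (x0 + (m : ℤ) * r) [ZMOD ((m : ℤ) * q)] ↔ g ≡ r [ZMOD q]
    rw [Int.modEq_iff_dvd, Int.modEq_iff_dvd,
      show x0 + (m : ℤ) * r - (x0 + m * g) = m * (r - g) by ring, mul_dvd_mul_iff_left hm'.ne']
  have hinj : Set.InjOn j (range q : Set ℕ) := by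
    intro r hr r' hr' h
    have h1 := (key r r').1 (by rw [← h, hj])
    simp only [coe_range, Set.mem_Iio] at hr hr'
    rw [Int.emod_eq_of_lt (by positivity) (by exact_mod_cast hr),
      Int.emod_eq_of_lt (by positivity) (by exact_mod_cast hr')] at h1
    exact_mod_cast h1
  unfold En
  have h1 : ∑ r ∈ range q, LN f Q (cls γ' q r S) =
      ∑ R ∈ (range q).image j, LN f Q (cls γ (m * q) R S) := by
    rw [sum_image hinj]
    refine sum_congr rfl fun r hr => ?_
    congr 1
    ext x
    simp only [cls, mem_filter, and_congr_right_iff]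
    intro hx
    rw [hγ x hx]
    push_cast
    rw [key, Int.emod_eq_of_lt (a := (r : ℤ)) (by positivity)
      (by exact_mod_cast mem_range.1 hr)]
  rw [h1]
  refine sum_le_sum_of_subset_of_nonneg ?_ fun _ _ _ => LN_nonneg _ _ _
  intro R hR
  obtain ⟨r, _, rfl⟩ := mem_image.1 hR
  rw [mem_range]
  have h2 := Int.emod_lt_of_pos (x0 + (m : ℤ) * r) hmq
  rw [← hj] at h2
  exact_mod_cast h2

lemma Good.det {p : ℕ} [Fact p.Prime] {d : ℕ} (hd : d < p) {φ : Fin d → Polynomial ℤ}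
    (h : Good p d φ) (x0 : ℤ) : ¬ (p : ℤ) ∣ (Wr φ x0).det := by
  obtain ⟨u, hu, h⟩ := h
  exact det_good 0 (by omega) φ x0 u hu (fun i => by rw [h i, zero_add]) (Or.inl rfl)

lemma dec_res {p d n a : ℕ} [hp : Fact p.Prime] (hd : d < p) {K : ℝ} (hD : Dec p d (n - a) K)
    (hK : 0 ≤ K)
    (ha : 1 ≤ a) (han : a ≤ n) {Ω : Type} [Fintype Ω] (I : Finset ℤ) (γ : ℤ → ℤ) (f : ℤ → Ω → ℂ)
    (φ : Fin d → Polynomial ℤ) (hφ : Good p d φ)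
    (hM : Modul I f (p ^ (d * n)) (fun x i => (φ i).eval (γ x))) (x0 : ℤ)
    (hI : ∀ x ∈ I, (p : ℤ) ^ a ∣ γ x - x0) :
    LN f (d * (d + 1)) I ≤ K * Mn p d n a γ f I := by
  have hp0 := hp.out.pos
  have hγ : ∀ x ∈ I, γ x = x0 + (p : ℤ) ^ a * ((γ x - x0) / (p : ℤ) ^ a) := fun x hx => by
    rw [Int.mul_ediv_cancel' (hI x hx)]; ring
  have h1 := resc hp0 hD φ x0 (hφ.det hd x0) ha (B := d * n) (by rw [Nat.sub_add_cancel han]) I γ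
    (fun x => (γ x - x0) / (p : ℤ) ^ a) f hγ hM
  refine h1.trans ?_
  rw [Mn, ← mul_assoc]
  have h2 := En_param γ (fun x => (γ x - x0) / (p : ℤ) ^ a) f (d * (d + 1)) (p ^ (n - a)) (p ^ a)
    (by positivity) (by positivity) x0 I (by simpa using hγ)
  rw [← pow_add, Nat.add_sub_cancel' han] at h2
  gcongr

lemma bil_holder {Ω : Type} [Fintype Ω] (X Y : Ω → ℝ) (hX : ∀ ω, 0 ≤ X ω) (hY : ∀ ω, 0 ≤ Y ω)
    {Q α α1 α2 : ℕ} (h1 : α1 ≤ Q) (h2 : α2 ≤ Q) (h : α ≤ Q) {t : ℝ} (ht0 : 0 < t) (ht1 : t < 1)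
    (hQ : 0 < Q) (hα : (α : ℝ) = t * α1 + (1 - t) * α2) {mI mJ K1 K2 : ℝ} (hmI : 0 ≤ mI)
    (hmJ : 0 ≤ mJ) (hK1 : 0 ≤ K1) (hK2 : 0 ≤ K2)
    (H1 : ∑ ω, X ω ^ α1 * Y ω ^ (Q - α1) ≤
      K1 * (mI ^ ((α1 : ℝ) / (Q : ℝ)) * mJ ^ (1 - (α1 : ℝ) / (Q : ℝ))))
    (H2 : ∑ ω, X ω ^ α2 * Y ω ^ (Q - α2) ≤
      K2 * (mI ^ ((α2 : ℝ) / (Q : ℝ)) * mJ ^ (1 - (α2 : ℝ) / (Q : ℝ)))) :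
    ∑ ω, X ω ^ α * Y ω ^ (Q - α) ≤
      (K1 ^ t * K2 ^ (1 - t)) * (mI ^ ((α : ℝ) / (Q : ℝ)) * mJ ^ (1 - (α : ℝ) / (Q : ℝ))) := by
  have ht1' : 0 < 1 - t := by linarith
  have comb : ∀ z : ℝ, 0 ≤ z → ∀ a b : ℝ, 0 ≤ a → 0 ≤ b →
      (z ^ a) ^ t * (z ^ b) ^ (1 - t) = z ^ (t * a + (1 - t) * b) := by
    intro z hz a b ha hb
    rw [← Real.rpow_mul hz, ← Real.rpow_mul hz, ← Real.rpow_add_of_nonneg hz (by positivity)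
      (by positivity)]
    ring_nf
  have hQ' : (0 : ℝ) < Q := by exact_mod_cast hQ
  have hd1 : (α1 : ℝ) / Q ≤ 1 := by rw [div_le_one hQ']; exact_mod_cast h1
  have hd2 : (α2 : ℝ) / Q ≤ 1 := by rw [div_le_one hQ']; exact_mod_cast h2
  have e1 : ∑ ω, X ω ^ α * Y ω ^ (Q - α) =
      ∑ ω, (X ω ^ α1 * Y ω ^ (Q - α1)) ^ t * (X ω ^ α2 * Y ω ^ (Q - α2)) ^ (1 - t) := by
    refine sum_congr rfl fun ω _ => ?_
    have hx := hX ω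
    have hy := hY ω
    rw [Real.mul_rpow (by positivity) (by positivity), Real.mul_rpow (by positivity) (by positivity)]
    rw [← Real.rpow_natCast, ← Real.rpow_natCast, ← Real.rpow_natCast, ← Real.rpow_natCast,
      ← Real.rpow_natCast, ← Real.rpow_natCast]
    rw [mul_mul_mul_comm, comb _ hx _ _ (by positivity) (by positivity),
      comb _ hy _ _ (by positivity) (by positivity), ← hα]
    congr 2
    rw [Nat.cast_sub h, Nat.cast_sub h1, Nat.cast_sub h2, hα]; ring
  rw [e1]
  refine (holder univ _ _ (fun ω _ => ?_) (fun ω _ => ?_) ht0 ht1).trans ?_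
  · have hx := hX ω
    have hy := hY ω
    positivity
  · have hx := hX ω
    have hy := hY ω
    positivity
  have n1 : 0 ≤ ∑ ω, X ω ^ α1 * Y ω ^ (Q - α1) := sum_nonneg fun ω _ => by
    have hx := hX ω
    have hy := hY ω
    positivity
  have n2 : 0 ≤ ∑ ω, X ω ^ α2 * Y ω ^ (Q - α2) := sum_nonneg fun ω _ => by
    have hx := hX ω
    have hy := hY ω
    positivity
  refine (mul_le_mul (Real.rpow_le_rpow n1 H1 ht0.le) (Real.rpow_le_rpow n2 H2 ht1'.le)
    (by positivity) (by positivity)).trans (le_of_eq ?_)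
  rw [Real.mul_rpow hK1 (by positivity), Real.mul_rpow hK2 (by positivity),
    Real.mul_rpow (by positivity) (by positivity), Real.mul_rpow (by positivity) (by positivity),
    mul_mul_mul_comm, mul_mul_mul_comm ((mI ^ _) ^ t), comb _ hmI _ _ (by positivity) (by positivity),
    comb _ hmJ _ _ (by linarith) (by linarith)]
  congr 3
  · rw [hα]; ring
  · rw [hα]; ring

/-- Step: Hölder -/
lemma bil_step {p d l a b n : ℕ} (hl : 1 ≤ l) (hld : l < d) {K1 K2 : ℝ}
    (hK1 : 0 ≤ K1) (hK2 : 0 ≤ K2) (B1 : Bil p d (d - l) b a n K1) (B2 : Bil p d (l - 1) a b n K2) :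
    Bil p d l a b n (K1 ^ ((1 : ℝ) / ((d - l + 1 : ℕ) : ℝ)) *
      K2 ^ (1 - (1 : ℝ) / ((d - l + 1 : ℕ) : ℝ))) := by
  intro Ω _ I J γ f φ hφ hM x0 y0 hxy hI hJ
  obtain ⟨m, rfl⟩ := Nat.exists_eq_add_of_lt hld
  obtain ⟨l, rfl⟩ := Nat.exists_eq_add_of_le' hl
  have e1 : l + 1 + m + 1 - (l + 1) = m + 1 := by omega
  rw [e1] at B1 ⊢
  rw [Nat.add_sub_cancel] at B2
  have g1 := B1 Ω J I γ f φ hφ (by rwa [union_comm]) y0 x0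
    (fun h => hxy (by rw [← neg_sub]; exact (dvd_neg).2 h)) hJ hI
  have g2 := B2 Ω I J γ f φ hφ hM x0 y0 hxy hI hJ
  have hle : ∀ i j : ℕ, i ≤ j → i * (i + 1) ≤ j * (j + 1) := fun i j h =>
    Nat.mul_le_mul h (by omega)
  have hQ1 := hle (m + 1) (l + 1 + m + 1) (by omega)
  have hQ2 := hle l (l + 1 + m + 1) (by omega)
  have hQ3 := hle (l + 1) (l + 1 + m + 1) (by omega)
  have hQpos : 0 < (l + 1 + m + 1) * (l + 1 + m + 1 + 1) := by positivity
  refine bil_holder (fun ω => ‖∑ x ∈ I, f x ω‖) (fun ω => ‖∑ x ∈ J, f x ω‖)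
    (fun _ => norm_nonneg _) (fun _ => norm_nonneg _) (Nat.sub_le _ ((m + 1) * (m + 1 + 1))) hQ2 hQ3
    (t := (1 : ℝ) / ((m + 1 + 1 : ℕ) : ℝ)) (by positivity) ?_ hQpos ?_ (Mn_nonneg _ _ _ _ _ _ _)
    (Mn_nonneg _ _ _ _ _ _ _) hK1 hK2 ?_ g2
  · rw [div_lt_one (by positivity)]; push_cast; linarith [(Nat.cast_nonneg m : (0 : ℝ) ≤ m)]
  · rw [Nat.cast_sub hQ1]; push_cast; field_simp; ring
  · rw [Nat.sub_sub_self hQ1]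
    refine (le_of_eq (sum_congr rfl fun ω _ => mul_comm _ _)).trans (g1.trans (le_of_eq ?_))
    congr 1
    rw [mul_comm]
    have : (((l + 1 + m + 1) * (l + 1 + m + 1 + 1) - (m + 1) * (m + 1 + 1) : ℕ) : ℝ) /
        (((l + 1 + m + 1) * (l + 1 + m + 1 + 1) : ℕ) : ℝ) = 1 - (((m + 1) * (m + 1 + 1) : ℕ) : ℝ) /
        (((l + 1 + m + 1) * (l + 1 + m + 1 + 1) : ℕ) : ℝ) := by
      rw [Nat.cast_sub hQ1, sub_div, div_self (by positivity)]
    rw [this]; congr 2; ring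

/-- `l = 0` -/
lemma bil_zero {p d a b n : ℕ} [Fact p.Prime] (hd : d < p) {K : ℝ} (hK : 0 ≤ K)
    (hb : 1 ≤ b) (hbn : b ≤ n) (hD : Dec p d (n - b) K) : Bil p d 0 a b n K := by
  intro Ω _ I J γ f φ hφ hM x0 y0 hxy hI hJ
  have := dec_res hd hD hK hb hbn J γ f φ hφ (hM.mono subset_union_right) y0 hJ
  simpa [LN] using this

lemma bil_base {p d l a b n : ℕ} [Fact p.Prime] (hd : d < p) {K : ℝ} (hK : 0 ≤ K) (hl : 1 ≤ l)
    (hld : l < d) (ha : 1 ≤ a) (han : a ≤ n)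
    (hb : 1 ≤ b) (hbn : b ≤ n) (hDa : Dec p d (n - a) K) (hDb : Dec p d (n - b) K) :
    Bil p d l a b n K := by
  intro Ω _ I J γ f φ hφ hM x0 y0 hxy hI hJ
  have g1 := dec_res hd hDa hK ha han I γ f φ hφ (hM.mono subset_union_left) x0 hI
  have g2 := dec_res hd hDb hK hb hbn J γ f φ hφ (hM.mono subset_union_right) y0 hJ
  have hlt : l * (l + 1) < d * (d + 1) := Nat.mul_lt_mul'' hld (by omega)
  have hQpos : 0 < d * (d + 1) := by omega
  have hll : 0 < l * (l + 1) := by positivity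
  have hQ' : (0 : ℝ) < ((d * (d + 1) : ℕ) : ℝ) := by exact_mod_cast hQpos
  have := bil_holder (fun ω => ‖∑ x ∈ I, f x ω‖) (fun ω => ‖∑ x ∈ J, f x ω‖)
    (fun _ => norm_nonneg _) (fun _ => norm_nonneg _) le_rfl (Nat.zero_le _) hlt.le
    (t := ((l * (l + 1) : ℕ) : ℝ) / ((d * (d + 1) : ℕ) : ℝ)) (by positivity)
    (by rw [div_lt_one hQ']; exact_mod_cast hlt) hQpos
    (by rw [div_mul_cancel₀ _ hQ'.ne']; simp) (Mn_nonneg p d n a γ f I)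
    (Mn_nonneg p d n b γ f J) hK hK
    (by rw [div_self hQ'.ne']; simpa [LN] using g1) (by simpa [LN] using g2)
  rwa [← Real.rpow_add_of_nonneg hK (by positivity)
    (by rw [sub_nonneg, div_le_one hQ']; exact_mod_cast hlt.le), add_sub_cancel, Real.rpow_one] at this

end VM

open MeasureTheory Finset
open scoped Classical

namespace VM

lemma recn_map {p d : ℕ} {φ : Fin d → Polynomial ℤ} (h : Good p d φ) (y0 : ℤ)
    (j : Fin d) : (recn φ y0 j).map (Int.castRingHom (ZMod p)) =
      Polynomial.C (((Wr φ y0).det : ℤ) : ZMod p) * Polynomial.X ^ ((j : ℕ) + 1) := by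
  obtain ⟨u, hu, h⟩ := h
  ext m
  rw [Polynomial.coeff_map, Polynomial.coeff_C_mul, Polynomial.coeff_X_pow]
  rcases m with _ | m
  · simp [recn_coeff_zero]
  by_cases hm : m < d
  · have := recn_coeff_succ φ y0 j ⟨m, hm⟩
    simp only at this
    rw [this]
    by_cases hj : j = ⟨m, hm⟩
    · subst hj; simp
    · rw [if_neg hj, if_neg]
      · simp
      · intro h'; apply hj; ext; simp; omega
  · rw [if_neg (by have := j.2; omega)]
    simp only [recn, Polynomial.finsetSum_coeff, Polynomial.coeff_C_mul, Polynomial.coeff_sub,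
      Polynomial.coeff_C_succ, sub_zero, map_sum, map_mul, mul_zero]
    refine sum_eq_zero fun i _ => ?_
    have h1 : (Int.castRingHom (ZMod p)) ((Polynomial.taylor y0 (φ i)).coeff (m + 1)) = 0 := by
      rw [← Polynomial.coeff_map]
      have h2 : (Polynomial.taylor y0 (φ i)).map (Int.castRingHom (ZMod p)) =
          Polynomial.taylor ((Int.castRingHom (ZMod p)) y0)
            ((φ i).map (Int.castRingHom (ZMod p))) := by
        simp [Polynomial.taylor_apply, Polynomial.map_comp]
      rw [h2, h i]
      apply Polynomial.coeff_eq_zero_of_natDegree_lt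
      rw [Polynomial.natDegree_taylor]
      have := Polynomial.natDegree_C_mul_X_pow_le u ((i : ℕ) + 1)
      have := i.2
      omega
    rw [h1, mul_zero]

lemma half_cast (l : ℕ) (hl : 1 ≤ l) :
    ((l * (l + 1) / 2 - 1 : ℕ) : ℝ) = ((l * (l + 1) : ℕ) : ℝ) / 2 - 1 := by
  obtain ⟨c, hc⟩ := Nat.even_mul_succ_self l
  have : 1 * 2 ≤ l * (l + 1) := Nat.mul_le_mul hl (by omega)
  have h1 : l * (l + 1) / 2 = c := by omega
  rw [h1, hc, Nat.cast_sub (by omega)]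
  push_cast; ring

lemma bil_dec {p m l a a' b n : ℕ} [hp : Fact p.Prime] (hd : m + l < p) (hm : 1 ≤ m) (hl : 1 ≤ l)
    {K1 K2 : ℝ} (hK1 : 0 ≤ K1) (hK2 : 0 ≤ K2) (hD : Dec p l (a' - a) K1)
    (hB : Bil p (m + l) l a' b n K2) (ha : 1 ≤ a) (haa : a ≤ a') (han : a' ≤ n)
    (hla : l * a' ≤ (m + 1) * b) (hbn : b ≤ n) : Bil p (m + l) l a b n (K1 * K2) := by
  intro Ω _ I J γ f φ hφ hM x0 y0 hxy hI hJ
  have hp0 := hp.out.pos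
  obtain ⟨n', rfl⟩ := Nat.exists_eq_add_of_le haa
  rw [Nat.add_sub_cancel_left] at hD
  set Q := (m + l) * (m + l + 1) with hQ
  set L := l * (l + 1) with hL
  have hLpos : 0 < L := by positivity
  have hLQ : L < Q := Nat.mul_lt_mul'' (by omega) (by omega)
  set ρ : Fin l → Polynomial ℤ := fun i => recn φ y0 (Fin.natAdd m i) with hρ
  have hBdn : (m + 1) * b ≤ (m + l) * n := Nat.mul_le_mul (by omega) hbn
  have hM2 : Modul (I ∪ J) f (p ^ ((m + 1) * b)) (fun x i => (ρ i).eval (γ x - y0)) := by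
    refine (hM.recn φ y0 γ).change fun h' => ?_
    refine ⟨Fin.append (fun _ => 0) (fun i => (p : ℤ) ^ ((m + l) * n - (m + 1) * b) * h' i), 0,
      fun x _ => ?_⟩
    rw [Fin.sum_univ_add]
    simp only [Fin.append_left, Fin.append_right, zero_mul, sum_const_zero, zero_add]
    have : (p : ℝ) ^ ((m + l) * n) =
        (p : ℝ) ^ ((m + l) * n - (m + 1) * b) * (p : ℝ) ^ ((m + 1) * b) := by
      rw [← pow_add, Nat.sub_add_cancel hBdn]
    push_cast
    rw [this, ← mul_div_mul_left _ ((p : ℝ) ^ ((m + 1) * b)) (c := (p : ℝ) ^ ((m + l) * n - (m + 1) * b))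
      (by positivity), mul_sum]
    congr 1
    refine sum_congr rfl fun i _ => by rw [mul_assoc]
  have hJd : ∀ x ∈ J, ∀ i, (p : ℤ) ^ ((m + 1) * b) ∣ (ρ i).eval (γ x - y0) := by
    intro x hx i
    obtain ⟨g, hg⟩ := recn_dvd φ y0 (Fin.natAdd m i)
    simp only [hρ]
    rw [hg]
    simp only [Polynomial.eval_mul, Polynomial.eval_pow, Polynomial.eval_X, Fin.val_natAdd]
    refine Dvd.dvd.mul_right ?_ _
    rw [mul_comm (m + 1) b, pow_mul]
    exact (pow_dvd_pow_of_dvd (hJ x hx) (m + 1)).trans (pow_dvd_pow _ (by omega))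
  set r : ℝ := ((Q - L : ℕ) : ℝ) / (L : ℝ) with hr
  set F : ℤ → Ω → ℂ := fun x ω => f x ω * ((‖∑ y ∈ J, f y ω‖ ^ r : ℝ) : ℂ) with hF
  have hFnorm : ∀ (S : Finset ℤ) (ω : Ω), ‖∑ x ∈ S, F x ω‖ ^ L =
      ‖∑ x ∈ S, f x ω‖ ^ L * ‖∑ x ∈ J, f x ω‖ ^ (Q - L) := by
    intro S ω
    simp only [hF]
    rw [← sum_mul, norm_mul, mul_pow, Complex.norm_real, Real.norm_of_nonneg (by positivity),
      ← Real.rpow_natCast (‖∑ y ∈ J, f y ω‖ ^ r), ← Real.rpow_mul (norm_nonneg _), hr,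
      div_mul_cancel₀ _ (by positivity), Real.rpow_natCast]
  have hM3 : Modul I F (p ^ ((m + 1) * b)) (fun x i => (ρ i).eval (γ x - y0)) := by
    intro h
    obtain ⟨T, hT⟩ := hM2 h
    refine ⟨T, fun ω => ?_⟩
    obtain ⟨c, hc, h2⟩ := hT ω
    refine ⟨c, hc, fun x hx => ?_⟩
    have h3 : ∑ y ∈ J, f y (T ω) = c * ∑ y ∈ J, f y ω := by
      rw [mul_sum]
      refine sum_congr rfl fun y hy => ?_
      rw [h2 y (mem_union_right _ hy)]
      have : (p : ℤ) ^ ((m + 1) * b) ∣ ∑ i, h i * (ρ i).eval (γ y - y0) :=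
        dvd_sum fun i _ => (hJd y hy i).mul_left _
      obtain ⟨z, hz⟩ := this
      rw [hz]
      push_cast
      rw [mul_div_cancel_left₀ _ (by positivity), e_int, mul_one]
    simp only [hF]
    rw [h2 x (mem_union_left _ hx), h3, norm_mul, hc, one_mul]
    ring
  have hdet : ¬ (p : ℤ) ∣ (Wr ρ (x0 - y0)).det := by
    refine det_good m hd ρ (x0 - y0) (((Wr φ y0).det : ℤ) : ZMod p) ?_ (fun i => ?_) (Or.inr hxy)
    · rw [Ne, ZMod.intCast_zmod_eq_zero_iff_dvd]; exact hφ.det hd y0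
    · simp only [hρ]; rw [recn_map hφ]; simp
  have hγ : ∀ x ∈ I, γ x - y0 = (x0 - y0) + (p : ℤ) ^ a * ((γ x - x0) / (p : ℤ) ^ a) :=
    fun x hx => by rw [Int.mul_ediv_cancel' (hI x hx)]; ring
  have h1 := resc hp0 hD ρ (x0 - y0) hdet ha (B := (m + 1) * b)
    (by rw [add_comm n' a]; exact hla) I (fun x => γ x - y0)
    (fun x => (γ x - x0) / (p : ℤ) ^ a) F hγ hM3
  set γ' : ℤ → ℤ := fun x => (γ x - x0) / (p : ℤ) ^ a with hγ'
  set θ : ℝ := (L : ℝ) / (Q : ℝ) with hθ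
  have hQpos : (0 : ℝ) < Q := by exact_mod_cast (by omega : 0 < Q)
  have hθ0 : 0 < θ := by positivity
  have hθ1 : θ < 1 := by rw [hθ, div_lt_one hQpos]; exact_mod_cast hLQ
  set MJ := Mn p (m + l) n b γ f J with hMJ
  have hMJ0 : 0 ≤ MJ := Mn_nonneg _ _ _ _ _ _ _
  have h2 : ∀ R ∈ range (p ^ n'), LN F L (cls γ' (p ^ n') R I) ≤
      K2 * MJ ^ (1 - θ) * Mn p (m + l) n (a + n') γ f (cls γ' (p ^ n') R I) ^ θ := by
    intro R _
    have hsub : cls γ' (p ^ n') R I ⊆ I := filter_subset _ _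
    have := hB Ω (cls γ' (p ^ n') R I) J γ f φ hφ (hM.mono (union_subset_union_left hsub))
      (x0 + (p : ℤ) ^ a * R) y0 ?_ ?_ hJ
    · calc _ = ∑ ω, ‖∑ x ∈ cls γ' (p ^ n') R I, f x ω‖ ^ L * ‖∑ x ∈ J, f x ω‖ ^ (Q - L) := by
            unfold LN; exact sum_congr rfl fun ω _ => hFnorm _ _
        _ ≤ _ := this
        _ = _ := by ring
    · intro hdvd
      apply hxy
      have h3 : (p : ℤ) ∣ (p : ℤ) ^ a * R := (dvd_pow_self _ (by omega)).mul_right _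
      have := dvd_sub hdvd h3
      rwa [show x0 + (p : ℤ) ^ a * R - y0 - (p : ℤ) ^ a * R = x0 - y0 by ring] at this
    · intro x hx
      simp only [cls, mem_filter] at hx
      have h4 := Int.mul_ediv_add_emod (γ' x) ((p ^ n' : ℕ) : ℤ)
      rw [hx.2] at h4
      have h5 := hγ x hx.1
      push_cast at h4
      refine ⟨γ' x / (p : ℤ) ^ n', ?_⟩
      have h6 : γ x - x0 = (p : ℤ) ^ a * γ' x := by
        simp only [hγ']; linarith
      rw [pow_add]
      linear_combination h6 + (p : ℤ) ^ a * (-h4)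
  set s := Q / 2 - 1 with hs
  have h3 : (∑ R ∈ range (p ^ n'), Mn p (m + l) n (a + n') γ f (cls γ' (p ^ n') R I)) *
      (p : ℝ) ^ (n' * s) ≤ Mn p (m + l) n a γ f I := by
    unfold Mn
    rw [← mul_sum]
    have hpw : (p : ℝ) ^ ((n - a) * s) = (p : ℝ) ^ ((n - (a + n')) * s) * (p : ℝ) ^ (n' * s) := by
      rw [← pow_add, ← add_mul]; congr 2; omega
    rw [← hQ, ← hs, hpw, mul_right_comm]
    refine mul_le_mul_of_nonneg_left ?_ (by positivity)
    refine En_refine γ f (by omega) (p ^ n) I γ' (p ^ n') (p ^ n') ?_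
    intro x hx y hy hxy'
    have hx1 := hγ x hx
    have hy1 := hγ y hy
    change γ' x ≡ γ' y [ZMOD _]
    have h7 : γ x ≡ γ y [ZMOD ((p ^ n : ℕ) : ℤ)] := hxy'
    rw [Int.modEq_iff_dvd] at h7 ⊢
    have h8 : γ y - γ x = (p : ℤ) ^ a * (γ' y - γ' x) := by
      simp only [hγ']; linear_combination hy1 - hx1
    rw [h8] at h7
    have h9 : (p : ℤ) ^ a * (p : ℤ) ^ n' ∣ (p : ℤ) ^ a * (γ' y - γ' x) := by
      rw [← pow_add]; refine (pow_dvd_pow _ han).trans ?_; exact_mod_cast h7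
    push_cast
    exact (mul_dvd_mul_iff_left (by positivity)).1 h9
  have hMr : ∀ R ∈ range (p ^ n'), 0 ≤ Mn p (m + l) n (a + n') γ f (cls γ' (p ^ n') R I) :=
    fun R _ => Mn_nonneg _ _ _ _ _ _ _
  have h4 := holder_card (range (p ^ n')) _ hMr hθ0 hθ1
  set Sm := ∑ R ∈ range (p ^ n'), Mn p (m + l) n (a + n') γ f (cls γ' (p ^ n') R I) with hSm
  have hSm0 : 0 ≤ Sm := sum_nonneg hMr
  calc _ = LN F L I := by unfold LN; exact (sum_congr rfl fun ω _ => hFnorm _ _).symm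
    _ ≤ _ := h1
    _ ≤ K1 * (p : ℝ) ^ (n' * (L / 2 - 1)) * (K2 * MJ ^ (1 - θ) *
        (Sm ^ θ * ((range (p ^ n')).card : ℝ) ^ (1 - θ))) := by
      refine mul_le_mul_of_nonneg_left ?_ (by positivity)
      unfold En
      refine (sum_le_sum h2).trans ?_
      rw [← mul_sum]
      exact mul_le_mul_of_nonneg_left h4 (by positivity)
    _ = K1 * K2 * ((Sm * (p : ℝ) ^ (n' * s)) ^ θ * MJ ^ (1 - θ)) := by
      have key : (p : ℝ) ^ (n' * (L / 2 - 1)) * (((range (p ^ n')).card : ℝ)) ^ (1 - θ) =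
          ((p : ℝ) ^ (n' * s)) ^ θ := by
        rw [card_range]
        push_cast
        rw [pow_mul, pow_mul, ← Real.rpow_natCast _ (L / 2 - 1), ← Real.rpow_natCast _ s,
          ← Real.rpow_mul (by positivity), ← Real.rpow_add (by positivity)]
        congr 1
        rw [hs, hL, hQ, half_cast l hl, half_cast (m + l) (by omega), ← hL, ← hQ, hθ]
        field_simp
        ring
      rw [Real.mul_rpow hSm0 (by positivity), ← key]
      ring
    _ ≤ _ := by
      gcongr

end VM

open MeasureTheory Finset
open scoped Classical

namespace VM

lemma Mn_le {p d n a a' : ℕ} (hp : 1 ≤ p) (ha : a' ≤ a) {Ω : Type} [Fintype Ω] (γ : ℤ → ℤ)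
    (f : ℤ → Ω → ℂ) (hd : d ≠ 0) {q r : ℕ} (hr : r < q) (hq : q ∣ p ^ n) (S : Finset ℤ) :
    Mn p d n a γ f (cls γ q r S) ≤ Mn p d n a' γ f S := by
  have hp' : (1 : ℝ) ≤ p := by exact_mod_cast hp
  unfold Mn
  refine mul_le_mul (pow_le_pow_right₀ hp' ?_) ?_ (En_nonneg _ _ _ _ _) (by positivity)
  · exact Nat.mul_le_mul_right _ (by omega)
  · refine En_mono_sub γ f (by positivity) (p ^ n) S γ q q r hr ?_
    intro x _ y _ h
    have h1 : γ x ≡ γ y [ZMOD ((p ^ n : ℕ) : ℤ)] := h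
    exact h1.of_dvd (by exact_mod_cast hq)

lemma interp_le {x y M N θ : ℝ} (hx : 0 ≤ x) (hxM : x ≤ M) (hy : 0 ≤ y) (hyM : y ≤ N)
    (h0 : 0 ≤ θ) (h1 : θ ≤ 1) : x ^ θ * y ^ (1 - θ) ≤ M ^ θ * N ^ (1 - θ) := by
  have : 0 ≤ M := hx.trans hxM
  have : 0 ≤ N := hy.trans hyM
  have h2 : 0 ≤ 1 - θ := by linarith
  gcongr

lemma theta_mem {d l : ℕ} (hld : l < d) :
    0 ≤ ((l * (l + 1) : ℕ) : ℝ) / ((d * (d + 1) : ℕ) : ℝ) ∧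
    ((l * (l + 1) : ℕ) : ℝ) / ((d * (d + 1) : ℕ) : ℝ) ≤ 1 := by
  have hlt : l * (l + 1) < d * (d + 1) := Nat.mul_lt_mul'' hld (by omega)
  refine ⟨by positivity, ?_⟩
  rw [div_le_one (by exact_mod_cast (by omega))]
  exact_mod_cast hlt.le

lemma bil_triv {p d l b n : ℕ} [hp : Fact p.Prime] (hl : 1 ≤ l) (hld : l < d) (hb : 1 ≤ b)
    (hbn : b ≤ n) {K : ℝ} (hK : 0 ≤ K) (hB : Bil p d l 1 b n K) :
    Bil p d l 1 1 n ((p : ℝ) ^ (b * (d * (d + 1))) * K) := by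
  intro Ω _ I J γ f φ hφ hM x0 y0 hxy hI hJ
  have hp0 := hp.out.pos
  have hlt : l * (l + 1) < d * (d + 1) := Nat.mul_lt_mul'' hld (by omega)
  have hL : 0 < l * (l + 1) := by positivity
  obtain ⟨hθ0, hθ1⟩ := theta_mem hld
  set Q := d * (d + 1) with hQ
  set L := l * (l + 1)
  set θ : ℝ := ((L : ℕ) : ℝ) / ((Q : ℕ) : ℝ)
  have hbase : ∀ (S : Finset ℤ) (z0 : ℤ), (∀ x ∈ S, (p : ℤ) ^ 1 ∣ γ x - z0) → ∀ r : ℕ,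
      ∃ z : ℤ, (p : ℤ) ∣ z - z0 ∧ ∀ x ∈ cls γ (p ^ b) r S, (p : ℤ) ^ b ∣ γ x - z := by
    intro S z0 hS r
    by_cases hne : (cls γ (p ^ b) r S).Nonempty
    · obtain ⟨y, hy⟩ := hne
      refine ⟨γ y, ?_, ?_⟩
      · simpa using hS y (mem_filter.1 hy).1
      · intro x hx
        have h1 := (mem_filter.1 hy).2
        have h2 := (mem_filter.1 hx).2
        have : γ y ≡ γ x [ZMOD ((p ^ b : ℕ) : ℤ)] := h1.trans h2.symm
        rw [Int.modEq_iff_dvd] at this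
        exact_mod_cast this
    · exact ⟨z0, by simp, fun x hx => absurd ⟨x, hx⟩ hne⟩
  have hpair : ∀ r ∈ range (p ^ b), ∀ r' ∈ range (p ^ b),
      ∑ ω, ‖∑ x ∈ cls γ (p ^ b) r I, f x ω‖ ^ L * ‖∑ x ∈ cls γ (p ^ b) r' J, f x ω‖ ^ (Q - L) ≤
        K * (Mn p d n 1 γ f I ^ θ * Mn p d n 1 γ f J ^ (1 - θ)) := by
    intro r hr r' hr'
    obtain ⟨z, hz, hzI⟩ := hbase I x0 hI r
    obtain ⟨w, hw, hwJ⟩ := hbase J y0 hJ r'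
    refine (hB Ω _ _ γ f φ hφ (hM.mono (union_subset_union (filter_subset _ _)
      (filter_subset _ _))) z w ?_
      (fun x hx => (pow_dvd_pow _ hb).trans (hzI x hx)) hwJ).trans ?_
    · intro h
      apply hxy
      have := dvd_add (dvd_sub h hz) hw
      rwa [show z - w - (z - x0) + (w - y0) = x0 - y0 by ring] at this
    · refine mul_le_mul_of_nonneg_left ?_ hK
      exact interp_le (Mn_nonneg _ _ _ _ _ _ _)
        (Mn_le hp0 le_rfl γ f (by omega) (mem_range.1 hr) (pow_dvd_pow _ hbn) I)
        (Mn_nonneg _ _ _ _ _ _ _)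
        (Mn_le hp0 hb γ f (by omega) (mem_range.1 hr') (pow_dvd_pow _ hbn) J) hθ0 hθ1
  have hq : 0 < p ^ b := by positivity
  calc _ ≤ ∑ ω, (((p ^ b : ℕ) : ℝ) ^ (L - 1) * ∑ r ∈ range (p ^ b), ‖∑ x ∈ cls γ (p ^ b) r I, f x ω‖ ^ L) *
        (((p ^ b : ℕ) : ℝ) ^ (Q - L - 1) *
          ∑ r' ∈ range (p ^ b), ‖∑ x ∈ cls γ (p ^ b) r' J, f x ω‖ ^ (Q - L)) := by
        refine sum_le_sum fun ω _ => ?_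
        refine mul_le_mul (triv_pt γ f L (by omega) _ hq I ω)
          (triv_pt γ f (Q - L) (by omega) _ hq J ω) (by positivity) (by positivity)
    _ = ((p ^ b : ℕ) : ℝ) ^ (L - 1 + (Q - L - 1)) * ∑ r ∈ range (p ^ b), ∑ r' ∈ range (p ^ b),
        ∑ ω, ‖∑ x ∈ cls γ (p ^ b) r I, f x ω‖ ^ L *
          ‖∑ x ∈ cls γ (p ^ b) r' J, f x ω‖ ^ (Q - L) := by
        rw [sum_congr rfl fun r _ => sum_comm, sum_comm, mul_sum]
        refine sum_congr rfl fun ω _ => ?_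
        rw [mul_mul_mul_comm, ← pow_add, sum_mul_sum]
    _ ≤ ((p ^ b : ℕ) : ℝ) ^ (L - 1 + (Q - L - 1)) * ∑ r ∈ range (p ^ b), ∑ r' ∈ range (p ^ b),
        K * (Mn p d n 1 γ f I ^ θ * Mn p d n 1 γ f J ^ (1 - θ)) := by
        gcongr with r hr r' hr'
        exact hpair r hr r' hr'
    _ = _ := by
        rw [sum_const, sum_const, card_range, nsmul_eq_mul, nsmul_eq_mul,
          show b * Q = b * (L - 1 + (Q - L - 1)) + b + b by
            have : L - 1 + (Q - L - 1) + 1 + 1 = Q := by omega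
            nlinarith, pow_add (p : ℝ), pow_add (p : ℝ), pow_mul]
        push_cast
        ring

lemma bn_pt (p : ℕ) (hp : 1 ≤ p) (g : ℕ → ℝ) (hg : ∀ r, 0 ≤ g r) (Q L : ℕ) (hLQ : L ≤ Q) :
    (∑ r ∈ range p, g r) ^ Q ≤ 2 ^ Q * ∑ r ∈ range p, g r ^ Q +
      (p : ℝ) ^ (2 * Q) * ∑ r ∈ range p, ∑ r' ∈ (range p).erase r, g r ^ L * g r' ^ (Q - L) := by
  have hp' : (1 : ℝ) ≤ p := by exact_mod_cast hp
  obtain ⟨r0, hr0, hmax⟩ := exists_max_image (range p) g ⟨0, mem_range.2 (by omega)⟩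
  have n1 : 0 ≤ ∑ r ∈ range p, g r := sum_nonneg fun r _ => hg r
  have n2 : 0 ≤ ∑ r ∈ range p, g r ^ Q := sum_nonneg fun r _ => pow_nonneg (hg r) _
  have n3 : ∀ r, 0 ≤ ∑ r' ∈ (range p).erase r, g r ^ L * g r' ^ (Q - L) := fun r =>
    sum_nonneg fun r' _ => mul_nonneg (pow_nonneg (hg r) _) (pow_nonneg (hg r') _)
  have n4 : 0 ≤ ∑ r ∈ range p, ∑ r' ∈ (range p).erase r, g r ^ L * g r' ^ (Q - L) :=
    sum_nonneg fun r _ => n3 r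
  by_cases h : ∃ r' ∈ (range p).erase r0, g r0 ≤ p * g r'
  · obtain ⟨r', hr', h⟩ := h
    have h1 : ∑ r ∈ range p, g r ≤ p * g r0 := by
      refine (sum_le_card_nsmul _ _ _ hmax).trans ?_
      simp
    have h2 : g r0 ^ L * g r' ^ (Q - L) ≤
        ∑ r ∈ range p, ∑ r' ∈ (range p).erase r, g r ^ L * g r' ^ (Q - L) :=
      (single_le_sum (f := fun r' => g r0 ^ L * g r' ^ (Q - L))
        (fun r' _ => mul_nonneg (pow_nonneg (hg r0) _) (pow_nonneg (hg r') _)) hr').trans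
      (single_le_sum (f := fun r => ∑ r' ∈ (range p).erase r, g r ^ L * g r' ^ (Q - L))
        (fun r _ => n3 r) hr0)
    have g0 := hg r0
    have g1 := hg r'
    calc _ ≤ ((p : ℝ) * g r0) ^ Q := by gcongr
      _ = (p : ℝ) ^ Q * (g r0 ^ L * g r0 ^ (Q - L)) := by
        rw [mul_pow, ← pow_add, Nat.add_sub_cancel' hLQ]
      _ ≤ (p : ℝ) ^ Q * (g r0 ^ L * ((p : ℝ) * g r') ^ (Q - L)) := by gcongr
      _ = (p : ℝ) ^ Q * (p : ℝ) ^ (Q - L) * (g r0 ^ L * g r' ^ (Q - L)) := by rw [mul_pow]; ring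
      _ ≤ (p : ℝ) ^ Q * (p : ℝ) ^ Q *
          ∑ r ∈ range p, ∑ r' ∈ (range p).erase r, g r ^ L * g r' ^ (Q - L) := by
        refine mul_le_mul ?_ h2 (by positivity) (by positivity)
        gcongr
        omega
      _ ≤ _ := by
        rw [two_mul Q, pow_add]
        have : 0 ≤ 2 ^ Q * ∑ r ∈ range p, g r ^ Q := by positivity
        linarith
  · push Not at h
    have g0 := hg r0
    have h1 : ∑ r ∈ range p, g r ≤ 2 * g r0 := by
      rw [← add_sum_erase _ _ hr0, two_mul]
      gcongr
      have h2 : (p : ℝ) * ∑ r' ∈ (range p).erase r0, g r' ≤ p * g r0 := by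
        rw [mul_sum]
        refine (sum_le_card_nsmul _ _ (g r0) fun r hr => (h r hr).le).trans ?_
        rw [card_erase_of_mem hr0, card_range, nsmul_eq_mul]
        gcongr
        exact_mod_cast Nat.sub_le _ _
      exact le_of_mul_le_mul_left h2 (by linarith)
    calc _ ≤ (2 * g r0) ^ Q := by gcongr
      _ = 2 ^ Q * g r0 ^ Q := mul_pow _ _ _
      _ ≤ 2 ^ Q * ∑ r ∈ range p, g r ^ Q := by
        gcongr
        exact single_le_sum (f := fun r => g r ^ Q) (fun r _ => pow_nonneg (hg r) _) hr0
      _ ≤ _ := by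
        have : 0 ≤ (p : ℝ) ^ (2 * Q) *
          ∑ r ∈ range p, ∑ r' ∈ (range p).erase r, g r ^ L * g r' ^ (Q - L) := by positivity
        linarith

lemma broad_narrow {p d l n : ℕ} [hp : Fact p.Prime] (h8 : 8 ≤ p) (hd : d < p) (hl : 1 ≤ l)
    (hld : l < d) (hn : 1 ≤ n) {K1 K2 : ℝ} (hK1 : 0 ≤ K1) (hK2 : 0 ≤ K2)
    (hD : Dec p d (n - 1) K1) (hB : Bil p d l 1 1 n K2) :
    Dec p d n (K1 + (p : ℝ) ^ (2 * (d * (d + 1)) + 2) * K2) := by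
  intro Ω _ S γ f φ hφ hM
  have hp0 := hp.out.pos
  have hp1 : (1 : ℝ) ≤ p := by exact_mod_cast hp0
  have hlt : l * (l + 1) < d * (d + 1) := Nat.mul_lt_mul'' hld (by omega)
  have hd0 : d ≠ 0 := by omega
  have hQ6 : 2 * 3 ≤ d * (d + 1) := Nat.mul_le_mul (by omega) (by omega)
  obtain ⟨hθ0, hθ1⟩ := theta_mem hld
  set Q := d * (d + 1) with hQ
  set L := l * (l + 1)
  set θ : ℝ := ((L : ℕ) : ℝ) / ((Q : ℕ) : ℝ)
  set s := Q / 2 - 1 with hs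
  set E := En γ f Q (p ^ n) S with hE
  have hE0 : 0 ≤ E := En_nonneg _ _ _ _ _
  have hpn : p ∣ p ^ n := dvd_pow_self _ (by omega)
  have hcl : ∀ r, ∀ x ∈ cls γ p r S, (p : ℤ) ^ 1 ∣ γ x - r := by
    intro r x hx
    have := (mem_filter.1 hx).2
    rw [pow_one, ← this]
    exact Int.dvd_self_sub_emod
  have hpow : (p : ℝ) ^ ((n - 1) * s) * (p : ℝ) ^ s = (p : ℝ) ^ (n * s) := by
    rw [← pow_add]; congr 1
    obtain ⟨n, rfl⟩ := Nat.exists_eq_add_of_le' hn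
    simp; ring
  have h2s : (2 : ℝ) ^ Q ≤ (p : ℝ) ^ s := by
    calc (2 : ℝ) ^ Q ≤ 2 ^ (3 * s) := pow_le_pow_right₀ (by norm_num) (by
          obtain ⟨c, hc⟩ := Nat.even_mul_succ_self d
          omega)
      _ = 8 ^ s := by rw [pow_mul]; norm_num
      _ ≤ _ := by gcongr; exact_mod_cast h8
  have narrow : 2 ^ Q * ∑ r ∈ range p, LN f Q (cls γ p r S) ≤ K1 * (p : ℝ) ^ (n * s) * E := by
    have h1 : ∀ r ∈ range p, LN f Q (cls γ p r S) ≤ K1 * Mn p d n 1 γ f (cls γ p r S) :=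
      fun r _ => dec_res hd hD hK1 le_rfl hn _ γ f φ hφ (hM.mono (filter_subset _ _)) r (hcl r)
    have h2 : ∑ r ∈ range p, Mn p d n 1 γ f (cls γ p r S) ≤ (p : ℝ) ^ ((n - 1) * s) * E := by
      unfold Mn
      rw [← mul_sum]
      gcongr
      refine En_refine γ f (by omega) (p ^ n) S γ p p ?_
      intro x _ y _ h
      have h1 : γ x ≡ γ y [ZMOD ((p ^ n : ℕ) : ℤ)] := h
      exact h1.of_dvd (by exact_mod_cast hpn)
    calc _ ≤ (p : ℝ) ^ s * (K1 * ((p : ℝ) ^ ((n - 1) * s) * E)) := by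
          gcongr
          · exact sum_nonneg fun _ _ => LN_nonneg _ _ _
          refine (sum_le_sum h1).trans ?_
          rw [← mul_sum]
          gcongr
      _ = _ := by rw [← hpow]; ring
  have broad : ∀ r ∈ range p, ∀ r' ∈ (range p).erase r,
      ∑ ω, ‖∑ x ∈ cls γ p r S, f x ω‖ ^ L * ‖∑ x ∈ cls γ p r' S, f x ω‖ ^ (Q - L) ≤
        K2 * ((p : ℝ) ^ (n * s) * E) := by
    intro r hr r' hr'
    rw [mem_erase] at hr'
    refine (hB Ω _ _ γ f φ hφ (hM.mono (union_subset (filter_subset _ _)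
      (filter_subset _ _))) r r' ?_ (hcl r) (hcl r')).trans ?_
    · intro h
      have h1 : (r' : ℤ) ≡ r [ZMOD p] := Int.modEq_iff_dvd.2 h
      have h2 := Int.natCast_modEq_iff.1 h1
      exact hr'.1 (h2.eq_of_lt_of_lt (mem_range.1 hr'.2) (mem_range.1 hr))
    · refine mul_le_mul_of_nonneg_left ?_ hK2
      refine (interp_le (Mn_nonneg _ _ _ _ _ _ _)
        (Mn_le (a' := 0) hp0 (Nat.zero_le 1) γ f hd0 (mem_range.1 hr) hpn S)
        (Mn_nonneg _ _ _ _ _ _ _)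
        (Mn_le (a' := 0) hp0 (Nat.zero_le 1) γ f hd0 (mem_range.1 hr'.2) hpn S) hθ0 hθ1).trans
        (le_of_eq ?_)
      rw [← Real.rpow_add_of_nonneg (Mn_nonneg _ _ _ _ _ _ _) hθ0 (by linarith),
        add_sub_cancel, Real.rpow_one]
      rfl
  calc LN f Q S ≤ ∑ ω, (2 ^ Q * ∑ r ∈ range p, ‖∑ x ∈ cls γ p r S, f x ω‖ ^ Q +
      (p : ℝ) ^ (2 * Q) * ∑ r ∈ range p, ∑ r' ∈ (range p).erase r,
        ‖∑ x ∈ cls γ p r S, f x ω‖ ^ L * ‖∑ x ∈ cls γ p r' S, f x ω‖ ^ (Q - L)) := by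
        refine sum_le_sum fun ω _ => ?_
        refine le_trans ?_ (bn_pt p hp0 (fun r => ‖∑ x ∈ cls γ p r S, f x ω‖)
          (fun _ => norm_nonneg _) Q L hlt.le)
        rw [← sum_cls γ p hp0 S]
        gcongr
        exact norm_sum_le _ _
    _ = 2 ^ Q * ∑ r ∈ range p, LN f Q (cls γ p r S) + (p : ℝ) ^ (2 * Q) *
        ∑ r ∈ range p, ∑ r' ∈ (range p).erase r, ∑ ω,
        ‖∑ x ∈ cls γ p r S, f x ω‖ ^ L * ‖∑ x ∈ cls γ p r' S, f x ω‖ ^ (Q - L) := by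
        unfold LN
        rw [sum_add_distrib, ← mul_sum, ← mul_sum, sum_comm]
        congr 2
        rw [sum_comm]
        exact sum_congr rfl fun r _ => sum_comm
    _ ≤ K1 * (p : ℝ) ^ (n * s) * E + (p : ℝ) ^ (2 * Q) *
        ∑ r ∈ range p, ∑ r' ∈ range p, K2 * ((p : ℝ) ^ (n * s) * E) := by
        gcongr with r hr
        refine (sum_le_sum (broad r hr)).trans ?_
        exact sum_le_sum_of_subset_of_nonneg (erase_subset _ _) fun _ _ _ => by positivity
    _ = _ := by
        rw [sum_const, sum_const, card_range, nsmul_eq_mul, nsmul_eq_mul, pow_add]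
        ring

lemma dec_triv {p d n : ℕ} (hp : 1 ≤ p) (hd : 1 ≤ d) :
    Dec p d n ((p : ℝ) ^ (n * (d * (d + 1)))) := by
  intro Ω _ S γ f φ hφ hM
  have hp1 : (1 : ℝ) ≤ p := by exact_mod_cast hp
  refine (triv_LN γ f (d * (d + 1)) (by positivity) (p ^ n) (by positivity) S).trans ?_
  refine mul_le_mul_of_nonneg_right ?_ (En_nonneg _ _ _ _ _)
  push_cast
  rw [← pow_mul]
  calc (p : ℝ) ^ (n * (d * (d + 1) - 1)) ≤ (p : ℝ) ^ (n * (d * (d + 1))) :=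
        pow_le_pow_right₀ hp1 (Nat.mul_le_mul_left _ (Nat.sub_le _ _))
    _ ≤ _ := le_mul_of_one_le_right (by positivity) (one_le_pow₀ hp1)

end VM

open MeasureTheory Finset
open scoped Classical

namespace VM

def Adm (p d : ℕ) (κ : ℝ) : Prop :=
  ∃ C > (0 : ℝ), ∀ n : ℕ, Dec p d n (C * (p : ℝ) ^ (κ * n))

def PP (p d : ℕ) (κ A : ℝ) (l c : ℕ) : Prop :=
  ∀ ε > (0 : ℝ), ∃ C > (0 : ℝ), ∀ n a b : ℕ, c ≤ b → 1 ≤ a → l * a ≤ (d - l + 1) * b → c * b ≤ n →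
    Bil p d l a b n (C * (p : ℝ) ^ (κ * (n - A * b) + ε * n))

noncomputable def Ac (d : ℕ) : ℕ → ℕ → ℝ
  | 0, l => if l = 0 then 1 else 0
  | t + 1, l => if l = 0 then 1 else
      Ac d t (d - l) / l + ((d - l : ℕ) : ℝ) / ((d - l + 1 : ℕ) : ℝ) * Ac d t (l - 1)

lemma Ac_nonneg (d t l : ℕ) : 0 ≤ Ac d t l := by
  induction t generalizing l with
  | zero => unfold Ac; split_ifs <;> norm_num
  | succ t ih =>
    unfold Ac
    split_ifs
    · norm_num
    · have h1 := ih (d - l)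
      have h2 := ih (l - 1)
      positivity

lemma Ac_zero (d t : ℕ) : Ac d t 0 = 1 := by
  cases t <;> simp [Ac]

lemma Ac_sum (d t : ℕ) (hd : 1 ≤ d) :
    ∑ l ∈ Ico 1 d, Ac d t l = t * ((d - 1 : ℝ) / d) := by
  induction t with
  | zero =>
    simp only [Nat.cast_zero, zero_mul]
    refine sum_eq_zero fun l hl => ?_
    rw [mem_Ico] at hl
    simp [Ac]; omega
  | succ t ih =>
    have h1 : ∑ l ∈ Ico 1 d, Ac d (t + 1) l = ∑ l ∈ Ico 1 d, (Ac d t (d - l) / l +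
        ((d - l : ℕ) : ℝ) / ((d - l + 1 : ℕ) : ℝ) * Ac d t (l - 1)) := by
      refine sum_congr rfl fun l hl => ?_
      rw [mem_Ico] at hl
      rw [Ac, if_neg (by omega)]
    have h2 : ∑ l ∈ Ico 1 d, Ac d t (d - l) / l = ∑ m ∈ Ico 1 d, Ac d t m / ((d - m : ℕ) : ℝ) := by
      refine sum_nbij' (fun l => d - l) (fun l => d - l) ?_ ?_ ?_ ?_ ?_
      · intro l hl; simp only [mem_Ico] at *; omega
      · intro l hl; simp only [mem_Ico] at *; omega
      · intro l hl; simp only [mem_Ico] at *; omega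
      · intro l hl; simp only [mem_Ico] at *; omega
      · intro l hl; simp only [mem_Ico] at *; congr 2; omega
    have h3 : ∑ l ∈ Ico 1 d, ((d - l : ℕ) : ℝ) / ((d - l + 1 : ℕ) : ℝ) * Ac d t (l - 1) =
        ∑ m ∈ range d, ((d - m - 1 : ℕ) : ℝ) / ((d - m : ℕ) : ℝ) * Ac d t m := by
      obtain ⟨d, rfl⟩ := Nat.exists_eq_add_of_le' hd
      rw [sum_range_succ, sum_Ico_eq_sum_range]
      simp only [Nat.add_sub_cancel, Nat.add_sub_cancel_left]
      simp only [Nat.sub_self, Nat.cast_zero, zero_div, zero_mul, add_zero]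
      refine sum_congr rfl fun m hm => ?_
      rw [mem_range] at hm
      rw [show d + 1 - (1 + m) = d - m by omega, show d + 1 - m - 1 = d - m by omega,
        show d + 1 - m = d - m + 1 by omega]
    have h4 : ∑ m ∈ range d, ((d - m - 1 : ℕ) : ℝ) / ((d - m : ℕ) : ℝ) * Ac d t m =
        (d - 1 : ℝ) / d + ∑ m ∈ Ico 1 d, ((d - m - 1 : ℕ) : ℝ) / ((d - m : ℕ) : ℝ) * Ac d t m := by
      rw [range_eq_Ico, sum_eq_sum_Ico_succ_bot (by omega)]
      congr 1
      rw [Ac_zero, Nat.sub_zero, Nat.cast_sub hd]; simp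
    rw [h1, sum_add_distrib, h2, h3, h4, add_left_comm, ← sum_add_distrib]
    have h5 : ∑ m ∈ Ico 1 d, (Ac d t m / ((d - m : ℕ) : ℝ) +
        ((d - m - 1 : ℕ) : ℝ) / ((d - m : ℕ) : ℝ) * Ac d t m) = ∑ m ∈ Ico 1 d, Ac d t m := by
      refine sum_congr rfl fun m hm => ?_
      rw [mem_Ico] at hm
      have : (0 : ℝ) < ((d - m : ℕ) : ℝ) := by exact_mod_cast (by omega)
      rw [Nat.cast_sub (by omega : 1 ≤ d - m)]
      field_simp
      push_cast
      ring
    rw [h5, ih]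
    push_cast
    ring

lemma pp_zero_l {p d : ℕ} [hp : Fact p.Prime] (hdp : d < p) {κ : ℝ} (h : Adm p d κ)
    {c : ℕ} (hc : 1 ≤ c) : PP p d κ 1 0 c := by
  obtain ⟨C, hC, h⟩ := h
  have hp1 : (1 : ℝ) ≤ p := by exact_mod_cast hp.out.pos
  intro ε hε
  refine ⟨C, hC, fun n a b hb ha _ hcb => ?_⟩
  have hbn : b ≤ n := (Nat.le_mul_of_pos_left b (by omega)).trans hcb
  have hbn' : (b : ℝ) ≤ n := by exact_mod_cast hbn
  refine (bil_zero hdp (by positivity) (by omega) hbn (h (n - b))).mono ?_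
  refine mul_le_mul_of_nonneg_left (Real.rpow_le_rpow_of_exponent_le hp1 ?_) hC.le
  rw [Nat.cast_sub hbn, one_mul]
  have : 0 ≤ ε * n := by positivity
  linarith

lemma pp_base {p d : ℕ} [hp : Fact p.Prime] (hdp : d < p) {κ : ℝ} (hκ : 0 ≤ κ) (h : Adm p d κ)
    {l : ℕ} (hl : 1 ≤ l) (hld : l < d) : PP p d κ 0 l d := by
  obtain ⟨C, hC, h⟩ := h
  have hp1 : (1 : ℝ) ≤ p := by exact_mod_cast hp.out.pos
  intro ε hε
  refine ⟨C, hC, fun n a b hb ha hab hcb => ?_⟩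
  have hbn : b ≤ n := (Nat.le_mul_of_pos_left b (by omega)).trans hcb
  have han : a ≤ n := (Nat.le_mul_of_pos_left a (by omega)).trans
    (hab.trans ((Nat.mul_le_mul_right b (by omega)).trans hcb))
  have key : ∀ z : ℕ, z ≤ n → C * (p : ℝ) ^ (κ * ((n - z : ℕ) : ℝ)) ≤ C * (p : ℝ) ^ (κ * n) := by
    intro z hz
    have : ((n - z : ℕ) : ℝ) ≤ n := by exact_mod_cast Nat.sub_le _ _
    refine mul_le_mul_of_nonneg_left (Real.rpow_le_rpow_of_exponent_le hp1 ?_) hC.le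
    gcongr
  refine (bil_base hdp (K := C * (p : ℝ) ^ (κ * n)) (by positivity) hl hld ha han (by omega) hbn
    ((h (n - a)).mono (key a han)) ((h (n - b)).mono (key b hbn))).mono ?_
  refine mul_le_mul_of_nonneg_left (Real.rpow_le_rpow_of_exponent_le hp1 ?_) hC.le
  have : 0 ≤ ε * n := by positivity
  rw [zero_mul, sub_zero]
  linarith

lemma pp_step {p m l : ℕ} [hp : Fact p.Prime] (hdp : m + l < p) (hm : 1 ≤ m) (hl : 1 ≤ l) {κ : ℝ}
    (hκ : 0 ≤ κ) (hA : ∀ ε > 0, Adm p l ε) {A1 A2 : ℝ} (hA1 : 0 ≤ A1) {c : ℕ}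
    (hc : m + l ≤ c) (P1 : PP p (m + l) κ A1 m c) (P2 : PP p (m + l) κ A2 (l - 1) c) :
    PP p (m + l) κ (A1 / l + (m : ℝ) / ((m + 1 : ℕ) : ℝ) * A2) l ((m + l) * c) := by
  have hp1 : (1 : ℝ) ≤ p := by exact_mod_cast hp.out.pos
  have hp0 : (0 : ℝ) < p := by linarith
  intro ε hε
  obtain ⟨C1, hC1, h1⟩ := hA (ε / 2) (by positivity)
  obtain ⟨C2, hC2, h2⟩ := P1 (ε / 2) (by positivity)
  obtain ⟨C3, hC3, h3⟩ := P2 (ε / 2) (by positivity)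
  set t : ℝ := (1 : ℝ) / ((m + 1 : ℕ) : ℝ) with ht
  refine ⟨C1 * (C2 ^ t * C3 ^ (1 - t)) * (p : ℝ) ^ (κ * A1), by positivity,
    fun n a b hb ha hab hcb => ?_⟩
  rw [Nat.add_sub_cancel] at hab
  set a' := (m + 1) * b / l with ha'
  have hal : l * a' ≤ (m + 1) * b := Nat.mul_div_le _ _
  have hal2 : (m + 1) * b < l * (a' + 1) := by
    have h := Nat.div_add_mod ((m + 1) * b) l
    have h' := Nat.mod_lt ((m + 1) * b) (show l > 0 by omega)
    rw [mul_add, mul_one, ha']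
    omega
  have haa : a ≤ a' := by rw [ha', Nat.le_div_iff_mul_le (by omega), mul_comm]; exact hab
  have hcb0 : c ≤ b := (Nat.le_mul_of_pos_left c (by omega)).trans hb
  have hbn : b ≤ n := (Nat.le_mul_of_pos_left b (Nat.mul_pos (by omega) (by omega))).trans hcb
  have hca' : c ≤ a' := by
    rw [ha', Nat.le_div_iff_mul_le (by omega)]
    nlinarith
  have hadb : a' ≤ (m + l) * b := by
    calc a' ≤ (m + 1) * b := Nat.div_le_self _ _
      _ ≤ _ := Nat.mul_le_mul_right _ (by omega)
  have hca'n : c * a' ≤ n := by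
    calc c * a' ≤ c * ((m + l) * b) := Nat.mul_le_mul_left _ hadb
      _ = (m + l) * c * b := by ring
      _ ≤ n := hcb
  have ha'n : a' ≤ n := (Nat.le_mul_of_pos_left a' (by omega)).trans hca'n
  have B1 := h2 n b a' hca' (by omega) (by
    rw [Nat.add_sub_cancel_left]
    by_contra hcon
    push Not at hcon
    nlinarith) hca'n
  have B2 := h3 n a' b hcb0 (by omega) (by
    obtain ⟨l, rfl⟩ := Nat.exists_eq_add_of_le' hl
    rw [Nat.add_sub_cancel]
    rw [show m + (l + 1) - l + 1 = m + 2 by omega]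
    nlinarith) ((Nat.mul_le_mul_right b (Nat.le_mul_of_pos_left c (by omega))).trans hcb)
  have B3 := bil_step (p := p) (d := m + l) (l := l) (a := a') (b := b) (n := n) hl (by omega)
    (K1 := C2 * (p : ℝ) ^ (κ * (n - A1 * a') + ε / 2 * n))
    (by positivity) (by positivity) (by rw [Nat.add_sub_cancel]; exact B1) B2
  rw [Nat.add_sub_cancel, ← ht] at B3
  refine (bil_dec hdp hm hl (by positivity) (by positivity) (h1 (a' - a)) B3 ha haa ha'n hal
    hbn).mono ?_
  rw [Real.mul_rpow hC2.le (by positivity), Real.mul_rpow hC3.le (by positivity),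
    ← Real.rpow_mul hp0.le, ← Real.rpow_mul hp0.le]
  have e1 : ∀ x y z w u v : ℝ, C1 * (p : ℝ) ^ x * (C2 ^ t * (p : ℝ) ^ y * (C3 ^ (1 - t) * (p : ℝ) ^ z)) =
      (C1 * (C2 ^ t * C3 ^ (1 - t))) * (p : ℝ) ^ (x + y + z) := by
    intro x y z w u v
    rw [Real.rpow_add hp0, Real.rpow_add hp0]; ring
  rw [e1 _ _ _ 0 0 0, mul_assoc _ ((p : ℝ) ^ (κ * A1)), ← Real.rpow_add hp0]
  refine mul_le_mul_of_nonneg_left (Real.rpow_le_rpow_of_exponent_le hp1 ?_) (by positivity)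
  have r1 : ((a' - a : ℕ) : ℝ) ≤ n := by exact_mod_cast (Nat.sub_le _ _).trans ha'n
  have hl' : (0 : ℝ) < l := by exact_mod_cast hl
  have hm' : (0 : ℝ) < ((m + 1 : ℕ) : ℝ) := by positivity
  have r2 : (b : ℝ) / l ≤ t * a' + t := by
    have : (((m + 1) * b : ℕ) : ℝ) ≤ ((l * (a' + 1) : ℕ) : ℝ) := by exact_mod_cast hal2.le
    push_cast at this
    rw [ht]
    push_cast
    rw [div_le_iff₀ hl']
    field_simp
    linarith
  have ht1 : t ≤ 1 := by
    rw [ht, div_le_one hm']; push_cast; linarith [(Nat.cast_nonneg m : (0 : ℝ) ≤ m)]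
  have r3 : (m : ℝ) / ((m + 1 : ℕ) : ℝ) = 1 - t := by
    rw [ht]; push_cast; field_simp; ring
  have r4 : κ * A1 * (b / l) ≤ κ * A1 * (t * a' + t) := by gcongr
  have r5 : κ * A1 * t ≤ κ * A1 := mul_le_of_le_one_right (by positivity) ht1
  have r6 : ε / 2 * ((a' - a : ℕ) : ℝ) ≤ ε / 2 * n := by gcongr
  rw [r3]
  have r7 : A1 / l * b = A1 * (b / l) := by ring
  have r8 : κ * (n - (A1 / l + (1 - t) * A2) * b) = κ * n - κ * A1 * (b / l) - κ * (1 - t) * A2 * b := by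
    rw [add_mul, r7]; ring
  rw [r8]
  linarith

lemma pp_all {p d : ℕ} [hp : Fact p.Prime] (hdp : d < p) {κ : ℝ} (hκ : 0 ≤ κ) (h : Adm p d κ)
    (hA : ∀ l, 1 ≤ l → l < d → ∀ ε > 0, Adm p l ε) (t : ℕ) :
    ∀ l < d, PP p d κ (Ac d t l) l (d ^ (t + 1)) := by
  induction t with
  | zero =>
    intro l hl
    rw [zero_add, pow_one]
    by_cases h0 : l = 0
    · subst h0; simpa [Ac] using pp_zero_l hdp h (by omega)
    · simpa [Ac, h0] using pp_base hdp hκ h (by omega) hl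
  | succ t ih =>
    intro l hl
    by_cases h0 : l = 0
    · subst h0; rw [Ac_zero]; exact pp_zero_l hdp h (Nat.one_le_pow _ _ hl)
    · rw [Ac, if_neg h0, pow_succ' _ (t + 1)]
      obtain ⟨m, rfl⟩ := Nat.exists_eq_add_of_le' hl.le
      have h1 := ih m (by omega)
      have h2 := ih (l - 1) (by omega)
      rw [Nat.add_sub_cancel]
      exact pp_step hdp (by omega) (by omega) hκ (hA l (by omega) hl) (Ac_nonneg _ _ _)
        (Nat.le_self_pow (by omega) _) h1 h2

end VM

open MeasureTheory Finset
open scoped Classical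

namespace VM

lemma improve {p d : ℕ} [hp : Fact p.Prime] (h8 : 8 ≤ p) (hdp : d < p) (hd : 2 ≤ d)
    (hA : ∀ l, 1 ≤ l → l < d → ∀ ε > 0, Adm p l ε) {κs : ℝ} (hκs : 0 < κs) :
    ∃ δ > (0 : ℝ), ∀ κ ≥ κs, Adm p d κ → Adm p d (max κs (κ - δ)) := by
  have hp1 : (1 : ℝ) < p := by exact_mod_cast hp.out.one_lt
  have hp0 : (0 : ℝ) < p := by linarith
  set Q := d * (d + 1) with hQ
  have hd0 : (0 : ℝ) < d := by exact_mod_cast (by omega)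
  obtain ⟨t, ht⟩ := exists_nat_ge ((Q + 1) * d / κs)
  obtain ⟨l, hl, hAl⟩ : ∃ l ∈ Ico 1 d, (t : ℝ) / d ≤ Ac d t l := by
    refine exists_le_of_sum_le ⟨1, by simp; omega⟩ ?_
    rw [Ac_sum d t (by omega), sum_const, Nat.card_Ico, nsmul_eq_mul, Nat.cast_sub (by omega)]
    apply le_of_eq; push_cast; ring
  rw [mem_Ico] at hl
  set A := Ac d t l with hAdef
  have hA0 : 0 ≤ A := Ac_nonneg _ _ _
  have hκA : (Q : ℝ) + 1 ≤ κs * A := by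
    rw [div_le_iff₀ hκs] at ht
    calc (Q : ℝ) + 1 = (Q + 1) * d / d := by field_simp
      _ ≤ t * κs / d := by gcongr
      _ = κs * (t / d) := by ring
      _ ≤ _ := by gcongr
  set c := d ^ (t + 1) with hc
  have hdc : d ≤ c := Nat.le_self_pow (by omega) _
  have hc0 : (0 : ℝ) < c := by exact_mod_cast (by omega)
  refine ⟨1 / (2 * c), by positivity, fun κ hκ hAdm => ?_⟩
  set δ : ℝ := 1 / (2 * c) with hδ
  have hδ0 : 0 < δ := by positivity
  obtain ⟨C1, hC1, hP⟩ := pp_all hdp (by linarith) hAdm hA t l hl.2 δ hδ0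
  set κ' := max κs (κ - δ) with hκ'
  have hκ'0 : 0 < κ' := lt_of_lt_of_le hκs (le_max_left _ _)
  set q : ℝ := (p : ℝ) ^ (-κ') with hq
  have hq1 : q < 1 := Real.rpow_lt_one_of_one_lt_of_neg hp1 (by linarith)
  have hq1' : 0 < 1 - q := by linarith
  set C2 : ℝ := (p : ℝ) ^ (2 * Q + 2) * C1 * p with hC2
  have hC20 : 0 < C2 := by positivity
  set C3 : ℝ := (p : ℝ) ^ (c * c * Q) + C2 / (1 - q) with hC3
  have hC30 : 0 < C3 := by positivity
  refine ⟨C3, hC30, fun n => ?_⟩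
  induction n with
  | zero =>
    refine (dec_triv hp.out.pos (by omega)).mono ?_
    have h1 : (1 : ℝ) ≤ (p : ℝ) ^ (c * c * Q) := one_le_pow₀ hp1.le
    have h2 : 0 < C2 / (1 - q) := by positivity
    simp only [zero_mul, pow_zero, Nat.cast_zero, mul_zero, Real.rpow_zero, mul_one]
    linarith
  | succ n ih =>
    by_cases hn : n + 1 < c * c
    · refine (dec_triv hp.out.pos (by omega)).mono ?_
      calc (p : ℝ) ^ ((n + 1) * (d * (d + 1))) ≤ (p : ℝ) ^ (c * c * Q) :=
            pow_le_pow_right₀ hp1.le (Nat.mul_le_mul_right _ hn.le)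
        _ ≤ C3 := by
            have h2 : 0 < C2 / (1 - q) := by positivity
            linarith
        _ ≤ _ := le_mul_of_one_le_right hC30.le (Real.one_le_rpow hp1.le (by positivity))
    · push Not at hn
      set N := n + 1 with hN
      set b := N / c with hb
      have hcpos : 0 < c := by omega
      have hcb : c ≤ b := by rw [hb, Nat.le_div_iff_mul_le hcpos]; exact hn
      have hbN : c * b ≤ N := Nat.mul_div_le _ _
      have hb1 : b ≤ N := Nat.div_le_self _ _
      have hbl : (N : ℝ) / c ≤ b + 1 := by
        have h := Nat.div_add_mod N c
        have h' := Nat.mod_lt N hcpos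
        have h3 : N ≤ c * (b + 1) := by rw [mul_add, mul_one, hb]; omega
        rw [div_le_iff₀ hc0]
        have : (N : ℝ) ≤ ((c * (b + 1) : ℕ) : ℝ) := by exact_mod_cast h3
        push_cast at this
        linarith
      have B1 := hP N 1 b hcb le_rfl (by
        have : 1 * b ≤ (d - l + 1) * b := Nat.mul_le_mul_right _ (by omega)
        omega) hbN
      have B2 := bil_triv hl.1 hl.2 (by omega) hb1 (by positivity) B1
      refine (broad_narrow h8 hdp hl.1 hl.2 (n := N) (by omega) (by positivity) (by positivity) ih
        B2).mono ?_
      have key : (p : ℝ) ^ (b * Q) * (C1 * (p : ℝ) ^ (κ * (N - A * b) + δ * N)) ≤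
          C1 * (p * (p : ℝ) ^ (κ' * N)) := by
        rw [mul_left_comm, ← Real.rpow_natCast, ← Real.rpow_add hp0]
        refine mul_le_mul_of_nonneg_left ?_ hC1.le
        have : (p : ℝ) * (p : ℝ) ^ (κ' * N) = (p : ℝ) ^ (1 + κ' * N) := by
          rw [Real.rpow_add hp0, Real.rpow_one]
        rw [this]
        refine Real.rpow_le_rpow_of_exponent_le hp1.le ?_
        have k1 : (κ - δ) * N ≤ κ' * N := by gcongr; exact le_max_right _ _
        have k2 : (Q + 1) * b ≤ κ * A * b := by
          gcongr
          exact hκA.trans (by gcongr)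
        have k3 : 2 * δ * N = N / c := by rw [hδ]; field_simp
        push_cast
        nlinarith
      have hpn : (p : ℝ) ^ (κ' * n) = q * (p : ℝ) ^ (κ' * N) := by
        rw [hq, ← Real.rpow_add hp0]; congr 1; rw [hN]; push_cast; ring
      rw [hpn]
      have hC3q : C2 ≤ C3 * (1 - q) := by
        rw [hC3, add_mul, div_mul_cancel₀ _ hq1'.ne']
        have : 0 ≤ (p : ℝ) ^ (c * c * Q) * (1 - q) := by positivity
        linarith
      set Y := (p : ℝ) ^ (κ' * N) with hY
      have hY0 : 0 ≤ Y := by positivity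
      calc _ ≤ C3 * (q * Y) + (p : ℝ) ^ (2 * Q + 2) * (C1 * (p * Y)) := by gcongr
        _ = C3 * q * Y + C2 * Y := by rw [hC2]; ring
        _ ≤ C3 * q * Y + C3 * (1 - q) * Y := by gcongr
        _ = _ := by ring

lemma adm_step {p d : ℕ} [hp : Fact p.Prime] (h8 : 8 ≤ p) (hdp : d < p) (hd : 2 ≤ d)
    (hA : ∀ l, 1 ≤ l → l < d → ∀ ε > 0, Adm p l ε) : ∀ ε > 0, Adm p d ε := by
  intro ε hε
  have hp1 : (1 : ℝ) < p := by exact_mod_cast hp.out.one_lt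
  obtain ⟨δ, hδ, him⟩ := improve h8 hdp hd hA hε
  have h0 : ∀ j : ℕ, Adm p d (max ε ((d * (d + 1) : ℕ) - j * δ)) := by
    intro j
    induction j with
    | zero =>
      refine ⟨1, one_pos, fun n => (dec_triv hp.out.pos (by omega)).mono ?_⟩
      rw [one_mul, ← Real.rpow_natCast]
      refine Real.rpow_le_rpow_of_exponent_le hp1.le ?_
      rw [Nat.cast_mul n, mul_comm (n : ℝ)]
      gcongr
      simp
    | succ j ih =>
      have := him _ (le_max_left _ _) ih
      convert this using 1
      rw [← max_sub_sub_right, ← max_assoc, max_eq_left (by linarith : ε - δ ≤ ε)]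
      push_cast; ring_nf
  obtain ⟨j, hj⟩ := exists_nat_ge (((d * (d + 1) : ℕ) : ℝ) / δ)
  have := h0 j
  rwa [max_eq_left] at this
  rw [div_le_iff₀ hδ] at hj
  linarith

end VM

open MeasureTheory Finset
open scoped Classical

namespace VM

lemma LN2 {Ω : Type} [Fintype Ω] (f : ℤ → Ω → ℂ) (S : Finset ℤ) :
    ((LN f 2 S : ℝ) : ℂ) = ∑ x ∈ S, ∑ y ∈ S, ∑ ω, f x ω * (starRingEnd ℂ) (f y ω) := by
  unfold LN
  push_cast
  simp only [← Complex.mul_conj', map_sum, sum_mul_sum]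
  rw [sum_comm]
  refine sum_congr rfl fun x _ => ?_
  rw [sum_comm]

lemma good_one_inj {p : ℕ} [hp : Fact p.Prime] {φ : Polynomial ℤ} {u : ZMod p} (hu : u ≠ 0)
    (h : φ.map (Int.castRingHom (ZMod p)) = Polynomial.C u * Polynomial.X) (n : ℕ) (x y : ℤ)
    (hxy : (p : ℤ) ^ n ∣ φ.eval x - φ.eval y) : (p : ℤ) ^ n ∣ x - y := by
  obtain ⟨U, hU⟩ : ∃ U : ℤ, (U : ZMod p) = u := ⟨(u.val : ℤ), by simp⟩
  have h1 : (φ - Polynomial.C U * Polynomial.X).map (Int.castRingHom (ZMod p)) = 0 := by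
    rw [Polynomial.map_sub, h, Polynomial.map_mul, Polynomial.map_C, Polynomial.map_X]
    simp only [eq_intCast, hU, sub_self]
  have h2 : Polynomial.C (p : ℤ) ∣ φ - Polynomial.C U * Polynomial.X := by
    rw [Polynomial.C_dvd_iff_dvd_coeff]
    intro i
    have := congrArg (fun P => Polynomial.coeff P i) h1
    simp only [Polynomial.coeff_map, Polynomial.coeff_zero] at this
    exact (ZMod.intCast_zmod_eq_zero_iff_dvd _ _).1 this
  obtain ⟨ψ, hψ⟩ := h2
  obtain ⟨g, hg⟩ := Polynomial.sub_dvd_eval_sub x y ψ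
  have h3 : ∀ z, φ.eval z = U * z + p * ψ.eval z := by
    intro z
    have := congrArg (Polynomial.eval z) hψ
    simp at this
    linarith
  have h4 : φ.eval x - φ.eval y = (x - y) * (U + p * g) := by
    rw [h3, h3]; linear_combination (p : ℤ) * hg
  rw [h4] at hxy
  refine IsCoprime.dvd_of_dvd_mul_right (IsCoprime.pow_left ?_) hxy
  rw [(Nat.prime_iff_prime_int.1 hp.out).coprime_iff_not_dvd]
  intro h5
  apply hu
  rw [← hU, ZMod.intCast_zmod_eq_zero_iff_dvd]
  have := dvd_sub h5 (dvd_mul_right (p : ℤ) g)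
  simpa using this

lemma dec_one {p n : ℕ} [hp : Fact p.Prime] : Dec p 1 n 1 := by
  intro Ω _ S γ f φ hφ hM
  obtain ⟨u, hu, hφ⟩ := hφ
  have hp0 : (0 : ℝ) < p := by exact_mod_cast hp.out.pos
  have hz : ∀ x ∈ S, ∀ y ∈ S, γ x % ((p ^ n : ℕ) : ℤ) ≠ γ y % ((p ^ n : ℕ) : ℤ) →
      ∑ ω, f x ω * (starRingEnd ℂ) (f y ω) = 0 := by
    intro x hx y hy hne
    obtain ⟨T, hT⟩ := hM (fun _ => 1)
    set G := ∑ ω, f x ω * (starRingEnd ℂ) (f y ω) with hG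
    set a : ℝ := ((((φ 0).eval (γ x) - (φ 0).eval (γ y) : ℤ) : ℝ)) / (p : ℝ) ^ n with ha
    have h1 : G = e a * G := by
      conv_lhs => rw [hG, ← Equiv.sum_comp T]
      rw [hG, mul_sum]
      refine sum_congr rfl fun ω _ => ?_
      obtain ⟨c, hc, h2⟩ := hT ω
      rw [h2 x hx, h2 y hy]
      simp only [Fin.sum_univ_one, one_mul, map_mul, Fin.isValue]
      have hcc : c * (starRingEnd ℂ) c = 1 := by rw [Complex.mul_conj', hc]; norm_num
      have hee : ∀ b : ℝ, e b * (starRingEnd ℂ) (e b) = 1 := fun b => by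
        rw [Complex.mul_conj', norm_e]; norm_num
      have hab : ((((φ 0).eval (γ x) : ℤ) : ℝ)) / ((p ^ n : ℕ) : ℝ) =
          a + ((((φ 0).eval (γ y) : ℤ) : ℝ)) / ((p ^ n : ℕ) : ℝ) := by
        rw [ha]; push_cast; ring
      rw [hab, e_add]
      set B := ((((φ 0).eval (γ y) : ℤ) : ℝ)) / ((p ^ n : ℕ) : ℝ)
      linear_combination (e a * f x ω * (starRingEnd ℂ) (f y ω)) *
        ((e B * (starRingEnd ℂ) (e B)) * hcc + hee B)
    by_contra hG0
    have h2 : e a = 1 := by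
      have : (e a - 1) * G = 0 := by linear_combination -h1
      rcases mul_eq_zero.1 this with h | h
      · linear_combination h
      · exact absurd h hG0
    unfold e at h2
    rw [Complex.exp_eq_one_iff] at h2
    obtain ⟨z, hz⟩ := h2
    have h3 : (a : ℂ) = z := by
      have : (2 * Real.pi * Complex.I : ℂ) ≠ 0 := Complex.two_pi_I_ne_zero
      apply mul_left_cancel₀ this
      rw [hz]; ring
    have h4 : a = z := by exact_mod_cast h3
    rw [ha, div_eq_iff (by positivity)] at h4
    have h5 : (φ 0).eval (γ x) - (φ 0).eval (γ y) = z * (p : ℤ) ^ n := by exact_mod_cast h4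
    have h6 := good_one_inj hu (by simpa using hφ 0) n (γ x) (γ y) ⟨z, by rw [h5]; ring⟩
    apply hne
    have : γ y ≡ γ x [ZMOD ((p ^ n : ℕ) : ℤ)] := by
      rw [Int.modEq_iff_dvd]; exact_mod_cast h6
    exact this.symm
  have key : ((LN f 2 S : ℝ) : ℂ) = ((En γ f 2 (p ^ n) S : ℝ) : ℂ) := by
    unfold En
    push_cast
    simp only [LN2]
    rw [← sum_cls γ (p ^ n) (pow_pos hp.out.pos n) S (fun x => ∑ y ∈ S, ∑ ω, f x ω * (starRingEnd ℂ) (f y ω))]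
    refine sum_congr rfl fun r _ => sum_congr rfl fun x hx => ?_
    have hx' := mem_filter.1 hx
    symm
    refine sum_subset (filter_subset _ _) fun y hy hy' => ?_
    refine hz x hx'.1 y hy fun h => hy' ?_
    exact mem_filter.2 ⟨hy, by rw [← h, hx'.2]⟩
  have key' : LN f 2 S = En γ f 2 (p ^ n) S := by exact_mod_cast key
  simp [key']

theorem adm_all {p : ℕ} [hp : Fact p.Prime] (h8 : 8 ≤ p) (d : ℕ) (h1 : 1 ≤ d) (hdp : d < p) :
    ∀ ε > 0, Adm p d ε := by
  induction d using Nat.strong_induction_on with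
  | _ d ih =>
    by_cases hd : d = 1
    · subst hd
      intro ε hε
      refine ⟨1, one_pos, fun n => dec_one.mono ?_⟩
      have hp1 : (1 : ℝ) < p := by exact_mod_cast hp.out.one_lt
      rw [one_mul]
      exact Real.one_le_rpow hp1.le (by positivity)
    · exact adm_step h8 hdp (by omega) fun l hl hld => ih l hld hl (by omega)

end VM

open MeasureTheory Finset
open scoped Classical

namespace VM

noncomputable def W2 {ι β : Type*} (T : Finset ι) (W : ι → ℝ) (a : ι → β) : ℝ :=
  ∑ x ∈ T, ∑ y ∈ T, if a x = a y then W x * W y else 0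

lemma W2_eq {ι β : Type*} (T : Finset ι) (W : ι → ℝ) (a : ι → β) (A : Finset β)
    (hA : ∀ x ∈ T, a x ∈ A) : W2 T W a = ∑ m ∈ A, (∑ x ∈ T with a x = m, W x) ^ 2 := by
  unfold W2
  rw [← sum_fiberwise_of_maps_to hA]
  refine sum_congr rfl fun m _ => ?_
  rw [sq, sum_mul_sum]
  refine sum_congr rfl fun x hx => ?_
  rw [← sum_filter]
  refine sum_congr ?_ fun _ _ => rfl
  rw [(mem_filter.1 hx).2]
  ext y; simp only [mem_filter]; tauto

lemma drop {ι β δ : Type*} (T : Finset ι) (W : ι → ℝ) (a : ι → β) (b : ι → δ) (M : Finset δ)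
    (hM : ∀ x ∈ T, b x ∈ M) : W2 T W a ≤ M.card * W2 T W (fun x => (a x, b x)) := by
  rw [W2_eq T W a (T.image a) (fun x hx => mem_image_of_mem _ hx),
    W2_eq T W (fun x => (a x, b x)) (T.image a ×ˢ M)
      (fun x hx => mem_product.2 ⟨mem_image_of_mem _ hx, hM x hx⟩), sum_product, mul_sum]
  refine sum_le_sum fun m _ => ?_
  have h1 : ∑ x ∈ T with a x = m, W x =
      ∑ μ ∈ M, ∑ x ∈ T with (a x, b x) = (m, μ), W x := by
    rw [← sum_fiberwise_of_maps_to (s := T.filter (fun x => a x = m)) (t := M) (g := b)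
      (fun x hx => hM x (mem_filter.1 hx).1)]
    refine sum_congr rfl fun μ _ => ?_
    rw [filter_filter]
    simp only [Prod.mk.injEq]
  rw [h1]
  have := sq_sum_le_card_mul_sum_sq (s := M)
    (f := fun μ => ∑ x ∈ T with (a x, b x) = (m, μ), W x)
  convert this

lemma W2_mono {ι β δ : Type*} (T : Finset ι) (W : ι → ℝ) (hW : ∀ x ∈ T, 0 ≤ W x) (a : ι → β)
    (b : ι → δ) (h : ∀ x ∈ T, ∀ y ∈ T, a x = a y → b x = b y) : W2 T W a ≤ W2 T W b := by
  unfold W2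
  refine sum_le_sum fun x hx => sum_le_sum fun y hy => ?_
  have := mul_nonneg (hW x hx) (hW y hy)
  split_ifs with h1 h2 h2
  · rfl
  · exact absurd (h x hx y hy h1) h2
  · exact this
  · rfl

noncomputable def ch {N d : ℕ} [NeZero N] (b α : Fin d → ZMod N) : ℂ :=
  ZMod.stdAddChar (∑ i, α i * b i)

lemma ch_norm {N d : ℕ} [NeZero N] (b α : Fin d → ZMod N) : ‖ch b α‖ = 1 := by
  unfold ch; exact AddChar.norm_apply _ _

lemma ch_add {N d : ℕ} [NeZero N] (b b' α : Fin d → ZMod N) :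
    ch (b + b') α = ch b α * ch b' α := by
  unfold ch
  rw [← AddChar.map_add_eq_mul, ← sum_add_distrib]
  simp [mul_add]

lemma ch_sum {N d : ℕ} [NeZero N] (b : Fin d → ZMod N) :
    ∑ α, ch b α = if b = 0 then (N : ℂ) ^ d else 0 := by
  have h1 : ∑ α : Fin d → ZMod N, ch b α = ∏ i, ∑ a : ZMod N, ZMod.stdAddChar (a * b i) := by
    rw [Fintype.prod_sum]
    refine sum_congr rfl fun α _ => ?_
    unfold ch
    have key : ∀ s : Finset (Fin d), (ZMod.stdAddChar (∑ i ∈ s, α i * b i) : ℂ) =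
        ∏ i ∈ s, ZMod.stdAddChar (α i * b i) := by
      intro s
      induction s using Finset.induction_on with
      | empty => simp
      | insert i s hi ih => rw [sum_insert hi, prod_insert hi, AddChar.map_add_eq_mul, ih]
    exact key _
  have h2 : ∀ i, ∑ a : ZMod N, ZMod.stdAddChar (a * b i) = if b i = 0 then (N : ℂ) else 0 := by
    intro i
    have := AddChar.sum_mulShift (b i) (ZMod.isPrimitive_stdAddChar N)
    simpa [ZMod.card] using this
  rw [h1]
  simp only [h2]
  split_ifs with h
  · subst h; simp
  · obtain ⟨i, hi⟩ := Function.ne_iff.1 h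
    exact prod_eq_zero (mem_univ i) (if_neg hi)

lemma ch_conj {N d : ℕ} [NeZero N] (b b' α : Fin d → ZMod N) :
    ch b α * (starRingEnd ℂ) (ch b' α) = ch (b - b') α := by
  have h1 : ch b α = ch (b - b') α * ch b' α := by rw [← ch_add, sub_add_cancel]
  rw [h1, mul_assoc, Complex.mul_conj', ch_norm]; simp

lemma parseval {ι : Type*} {N d : ℕ} [NeZero N] (T : Finset ι) (W : ι → ℝ)
    (V : ι → Fin d → ZMod N) :
    ∑ α, ‖∑ x ∈ T, (W x : ℂ) * ch (V x) α‖ ^ 2 = (N : ℝ) ^ d * W2 T W V := by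
  have : ((∑ α, ‖∑ x ∈ T, (W x : ℂ) * ch (V x) α‖ ^ 2 : ℝ) : ℂ) =
      (((N : ℝ) ^ d * W2 T W V : ℝ) : ℂ) := by
    unfold W2
    push_cast
    simp only [← Complex.mul_conj', map_sum, sum_mul_sum, map_mul, Complex.conj_ofReal]
    rw [sum_comm, mul_sum]
    refine sum_congr rfl fun x _ => ?_
    rw [sum_comm, mul_sum]
    refine sum_congr rfl fun y _ => ?_
    have h1 : ∀ α, (W x : ℂ) * ch (V x) α * ((W y : ℂ) * (starRingEnd ℂ) (ch (V y) α)) =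
        W x * W y * ch (V x - V y) α := by
      intro α; rw [← ch_conj]; ring
    simp only [h1]
    rw [← mul_sum, ch_sum]
    by_cases h : V x = V y
    · rw [if_pos (sub_eq_zero.2 h), if_pos h]; push_cast; ring
    · rw [if_neg (fun h' => h (sub_eq_zero.1 h')), if_neg h]; push_cast; ring
  exact_mod_cast this

lemma e_cont : Continuous e := by unfold e; fun_prop

lemma e_conj (x : ℝ) : (starRingEnd ℂ) (e x) = e (-x) := by
  unfold e
  rw [← Complex.exp_conj]
  congr 1
  simp only [map_mul, Complex.conj_I, Complex.conj_ofReal, map_ofNat]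
  push_cast; ring

lemma e_int_integral (m : ℤ) : ∫ α in (0 : ℝ)..1, e (m * α) = if m = 0 then 1 else 0 := by
  split_ifs with h
  · subst h; simp [e]
  · have hc : (2 * Real.pi * Complex.I * m : ℂ) ≠ 0 :=
      mul_ne_zero Complex.two_pi_I_ne_zero (by exact_mod_cast h)
    have h1 : ∀ α : ℝ, e (m * α) = Complex.exp ((2 * Real.pi * Complex.I * m) * α) := by
      intro α; unfold e; congr 1; push_cast; ring
    simp only [h1]
    rw [integral_exp_mul_complex hc]
    have h2 : Complex.exp (2 * Real.pi * Complex.I * m * ((1 : ℝ) : ℂ)) = 1 := by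
      rw [Complex.exp_eq_one_iff]; exact ⟨m, by push_cast; ring⟩
    rw [h2]; simp

lemma parseval_cont {ι : Type*} (T : Finset ι) (W : ι → ℝ) (n : ι → ℤ) :
    ∫ α in (0 : ℝ)..1, ‖∑ x ∈ T, (W x : ℂ) * e (n x * α)‖ ^ 2 = W2 T W n := by
  have : ((∫ α in (0 : ℝ)..1, ‖∑ x ∈ T, (W x : ℂ) * e (n x * α)‖ ^ 2 : ℝ) : ℂ) =
      ((W2 T W n : ℝ) : ℂ) := by
    rw [← intervalIntegral.integral_ofReal]
    have h1 : ∀ α : ℝ, ((‖∑ x ∈ T, (W x : ℂ) * e (n x * α)‖ ^ 2 : ℝ) : ℂ) =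
        ∑ x ∈ T, ∑ y ∈ T, W x * W y * e (((n x - n y : ℤ) : ℝ) * α) := by
      intro α
      push_cast
      rw [← Complex.mul_conj', map_sum, sum_mul_sum]
      refine sum_congr rfl fun x _ => sum_congr rfl fun y _ => ?_
      rw [map_mul, Complex.conj_ofReal, e_conj, sub_mul, sub_eq_add_neg, e_add]
      ring
    simp only [h1]
    have hcont : ∀ m : ℤ, Continuous fun α : ℝ => e (m * α) := fun m =>
      e_cont.comp (by fun_prop)
    have hc : ∀ x y, Continuous (fun α : ℝ =>
        (W x : ℂ) * W y * e (((n x - n y : ℤ) : ℝ) * α)) :=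
      fun x y => continuous_const.mul (hcont _)
    have h3 : ∀ x ∈ T, IntervalIntegrable (fun α : ℝ =>
        ∑ y ∈ T, (W x : ℂ) * W y * e (((n x - n y : ℤ) : ℝ) * α)) volume 0 1 :=
      fun x _ => (continuous_finsetSum _ fun y _ => hc x y).intervalIntegrable _ _
    have h4 := intervalIntegral.integral_finsetSum h3
    refine h4.trans ?_
    unfold W2
    rw [Complex.ofReal_sum]
    refine sum_congr rfl fun x _ => ?_
    have h5 := intervalIntegral.integral_finsetSum (s := T) (μ := volume) (a := 0) (b := 1)
      (f := fun y => fun α : ℝ => (W x : ℂ) * W y * e (((n x - n y : ℤ) : ℝ) * α))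
      (fun y _ => (hc x y).intervalIntegrable _ _)
    refine h5.trans ?_
    rw [Complex.ofReal_sum]
    refine sum_congr rfl fun y _ => ?_
    rw [intervalIntegral.integral_const_mul, e_int_integral]
    by_cases h : n x = n y
    · rw [if_pos (sub_eq_zero.2 h), if_pos h]; push_cast; ring
    · rw [if_neg (fun h' => h (sub_eq_zero.1 h')), if_neg h]; push_cast; ring
  exact_mod_cast this

end VM

open MeasureTheory Finset
open scoped Classical

namespace VM

section poly
open Polynomial

noncomputable def rk (k d : ℕ) (i : Fin d) : ℤ[X] := if (i : ℕ) + 1 = d then X ^ k else X ^ ((i : ℕ) + 1)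

lemma taylor_coeff_pow (x0 : ℤ) (m j : ℕ) :
    (taylor x0 (X ^ m : ℤ[X])).coeff j = x0 ^ (m - j) * (m.choose j : ℤ) := by
  rw [taylor_apply, pow_comp, X_comp, coeff_X_add_C_pow]

lemma rk_det {k d : ℕ} (hd : 1 ≤ d) (x0 : ℤ) :
    (Wr (rk k d) x0).det = x0 ^ (k - d) * (k.choose d : ℤ) := by
  rw [Matrix.det_of_isLowerTriangular]
  · have hl : (⟨d - 1, by omega⟩ : Fin d) ∈ (univ : Finset (Fin d)) := mem_univ _
    rw [prod_eq_single_of_mem _ hl]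
    · have : d - 1 + 1 = d := by omega
      simp only [Wr, rk, this, if_true, taylor_coeff_pow]
    · intro i _ hi
      have h1 : ¬ ((i : ℕ) + 1 = d) := fun h => hi (Fin.ext (by simp; omega))
      simp only [Wr, rk, h1, if_false, taylor_coeff_pow]; simp
  · intro i j hij
    have hij' : (i : ℕ) < j := by simpa using hij
    have := j.2
    have h1 : ¬ ((i : ℕ) + 1 = d) := by omega
    simp only [Wr, rk, h1, if_false, taylor_coeff_pow]
    rw [Nat.choose_eq_zero_of_lt (by omega)]; simp

lemma rk_det_ndvd {p k d : ℕ} (hp : p.Prime) (hd : 1 ≤ d) (hdk : d ≤ k) (hkp : k < p) (x0 : ℤ)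
    (hx : ¬ (p : ℤ) ∣ x0) : ¬ (p : ℤ) ∣ (Wr (rk k d) x0).det := by
  rw [rk_det hd]
  have hp' : Prime (p : ℤ) := Nat.prime_iff_prime_int.1 hp
  intro h
  rcases hp'.dvd_or_dvd h with h | h
  · exact hx (hp'.dvd_of_dvd_pow h)
  · have h1 : p ∣ k.choose d := by exact_mod_cast h
    have h2 : p ∣ k.factorial := h1.trans (by
      rw [← Nat.choose_mul_factorial_mul_factorial hdk, mul_assoc]; exact dvd_mul_right _ _)
    have := (hp.dvd_factorial).1 h2
    omega

end poly

lemma ch_shift {N d : ℕ} [NeZero N] (b α h : Fin d → ZMod N) :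
    ch b (α + h) = ch b h * ch b α := by
  unfold ch
  rw [← AddChar.map_add_eq_mul, ← sum_add_distrib]
  simp [add_mul, add_comm]

lemma ch_int {N d : ℕ} [NeZero N] (b h : Fin d → ℤ) :
    ch (fun i => (b i : ZMod N)) (fun i => (h i : ZMod N)) =
      e (((∑ i, h i * b i : ℤ) : ℝ) / (N : ℝ)) := by
  unfold ch e
  rw [show (∑ i, (h i : ZMod N) * (b i : ZMod N)) = ((∑ i, h i * b i : ℤ) : ZMod N) by push_cast; rfl,
    ZMod.stdAddChar_coe]
  congr 1
  push_cast; ring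

noncomputable def ff {N d : ℕ} [NeZero N] (w : ℤ → ℝ) (v : ℤ → Fin d → ℤ) (x : ℤ)
    (α : Fin d → ZMod N) : ℂ := (w x : ℂ) * ch (fun i => (v x i : ZMod N)) α

lemma ff_modul {N d : ℕ} [NeZero N] (w : ℤ → ℝ) (v : ℤ → Fin d → ℤ) (S : Finset ℤ) :
    Modul S (ff (N := N) w v) N v := by
  intro h
  refine ⟨Equiv.addRight (fun i => (h i : ZMod N)), fun ω => ⟨1, by simp, fun x _ => ?_⟩⟩
  unfold ff
  rw [Equiv.coe_addRight, ch_shift, ch_int]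
  ring

lemma LN_single {N d : ℕ} [NeZero N] (w : ℤ → ℝ) (v : ℤ → Fin d → ℤ) (S : Finset ℤ) {Q : ℕ}
    (hQ : Q ≠ 0) {Wm : ℝ} (hWm : 0 ≤ Wm)
    (hw : ∀ x ∈ S, 0 ≤ w x ∧ w x ≤ Wm) (hS : S.card ≤ 1) :
    LN (ff (N := N) w v) Q S ≤ (N : ℝ) ^ d * Wm ^ Q := by
  rcases Finset.card_le_one_iff_subset_singleton.1 hS with ⟨x, hx⟩
  rcases Finset.subset_singleton_iff.1 hx with h | h
  · subst h; rw [LN_empty _ hQ]; positivity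
  · subst h
    obtain ⟨h0, h1⟩ := hw x (by simp)
    unfold LN ff
    simp only [sum_singleton, norm_mul, ch_norm, mul_one, Complex.norm_real, Real.norm_eq_abs,
      abs_of_nonneg h0]
    rw [sum_const, card_univ, nsmul_eq_mul]
    simp only [Fintype.card_pi, ZMod.card, prod_const, card_univ, Fintype.card_fin]
    push_cast
    gcongr

lemma disc_bound {p k d n : ℕ} [Fact p.Prime] [NeZero (p ^ (d * (n + 1)))] (hd : 1 ≤ d)
    (hdk : d ≤ k) (hkp : k < p) {K : ℝ} (hK : 0 ≤ K) (hD : Dec p d n K) (w : ℤ → ℝ) {Wm : ℝ}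
    (hWm : 0 ≤ Wm) (S : Finset ℤ) (hw : ∀ x ∈ S, 0 ≤ w x ∧ w x ≤ Wm)
    (hS : ∀ x ∈ S, 1 ≤ x ∧ x < (p : ℤ) ^ (n + 1) ∧ ¬ (p : ℤ) ∣ x) :
    LN (ff (N := p ^ (d * (n + 1))) w (fun x i => (rk k d i).eval x)) (d * (d + 1)) S ≤
      (p : ℝ) ^ (d * (d + 1) - 1) * (p * (K * (p : ℝ) ^ (n * (d * (d + 1) / 2 - 1)) *
        ((p : ℝ) ^ n * (((p ^ (d * (n + 1)) : ℕ) : ℝ) ^ d * Wm ^ (d * (d + 1)))))) := by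
  have hp : p.Prime := Fact.out
  have hp0 : 0 < p := hp.pos
  have hQ : d * (d + 1) ≠ 0 := by positivity
  refine (triv_LN (fun x => x) _ _ hQ p hp0 S).trans ?_
  refine mul_le_mul_of_nonneg_left ?_ (by positivity)
  unfold En
  refine (sum_le_card_nsmul (range p) _ (K * (p : ℝ) ^ (n * (d * (d + 1) / 2 - 1)) *
        ((p : ℝ) ^ n * (((p ^ (d * (n + 1)) : ℕ) : ℝ) ^ d * Wm ^ (d * (d + 1)))))
    fun r hr => ?_).trans_eq (by rw [card_range, nsmul_eq_mul])
  by_cases h0 : r = 0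
  · have : cls (fun x => x) p r S = ∅ := by
      apply filter_eq_empty_iff.2
      intro x hx h
      subst h0
      exact (hS x hx).2.2 (Int.dvd_of_emod_eq_zero (by simpa using h))
    rw [this, LN_empty _ hQ]; positivity
  · have hrp : ¬ (p : ℤ) ∣ (r : ℤ) := by
      intro h
      have h1 : p ∣ r := by exact_mod_cast h
      exact absurd (Nat.le_of_dvd (Nat.pos_of_ne_zero h0) h1) (not_le.2 (mem_range.1 hr))
    have hγ : ∀ x ∈ cls (fun x => x) p r S, x = (r : ℤ) + (p : ℤ) ^ 1 * (x / p) := by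
      intro x hx
      have h1 : x % (p : ℤ) = r := (mem_filter.1 hx).2
      have := Int.emod_add_mul_ediv x p
      rw [h1] at this
      rw [pow_one]; exact this.symm
    have hsub : cls (fun x => x) p r S ⊆ S := filter_subset _ _
    have h2 := resc (p := p) (l := d) (n' := n) (B := d * (n + 1)) (a := 1) hp0 hD (rk k d) (r : ℤ)
      (rk_det_ndvd hp hd hdk hkp _ hrp) le_rfl le_rfl (cls (fun x => x) p r S) (fun x => x)
      (fun x => x / p) (ff (N := p ^ (d * (n + 1))) w (fun x i => (rk k d i).eval x)) hγ
      (ff_modul _ _ _)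
    have h00 : 0 ≤ K * (p : ℝ) ^ (n * (d * (d + 1) / 2 - 1)) := by positivity
    refine h2.trans (mul_le_mul_of_nonneg_left ?_ h00)
    unfold En
    have hcard2 : (p : ℝ) ^ n = ((range (p ^ n)).card : ℝ) := by simp
    rw [hcard2, ← nsmul_eq_mul]
    refine sum_le_card_nsmul _ _ _ fun u hu => ?_
    refine LN_single w _ _ hQ hWm (fun x hx => hw x (hsub (mem_of_mem_filter x hx))) ?_
    rw [card_le_one]
    have key : ∀ x ∈ cls (fun x => x / (p : ℤ)) (p ^ n) u (cls (fun x => x) p r S),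
        x = r + p * u := by
      intro x hx
      obtain ⟨hx1, hx2⟩ := mem_filter.1 hx
      have h3 := hS x (hsub hx1)
      have h4 := hγ x hx1
      have hpz : (0 : ℤ) < p := by exact_mod_cast hp0
      have h5 : 0 ≤ x / (p : ℤ) := Int.ediv_nonneg (by omega) hpz.le
      have h6 : x / (p : ℤ) < ((p ^ n : ℕ) : ℤ) := by
        rw [Int.ediv_lt_iff_lt_mul hpz]; push_cast; rw [← pow_succ]; exact h3.2.1
      rw [Int.emod_eq_of_lt h5 h6] at hx2
      rw [hx2, pow_one] at h4
      exact h4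
    intro x hx y hy
    rw [key x hx, key y hy]

lemma LN_W2 {N d s : ℕ} [NeZero N] (w : ℤ → ℝ) (v : ℤ → Fin d → ℤ) (S : Finset ℤ) :
    LN (ff (N := N) w v) (2 * s) S = (N : ℝ) ^ d *
      W2 (Fintype.piFinset (fun _ : Fin s => S)) (fun t => ∏ j, w (t j))
        (fun t => fun i => ((∑ j, v (t j) i : ℤ) : ZMod N)) := by
  rw [← parseval]
  unfold LN
  refine sum_congr rfl fun α _ => ?_
  rw [mul_comm 2 s, pow_mul, ← norm_pow]
  congr 2
  have := Finset.prod_univ_sum (fun _ : Fin s => S) (fun _ x => ff (N := N) w v x α)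
  rw [prod_const, card_univ, Fintype.card_fin] at this
  rw [this]
  refine sum_congr rfl fun t _ => ?_
  unfold ff
  rw [prod_mul_distrib]
  push_cast
  congr 1
  have key : ∀ A : Finset (Fin s), ∏ j ∈ A, ch (fun i => (v (t j) i : ZMod N)) α =
      ch (fun i => ∑ j ∈ A, (v (t j) i : ZMod N)) α := by
    intro A
    induction A using Finset.induction_on with
    | empty => simp [ch]
    | insert a A ha ih =>
      rw [prod_insert ha, ih, ← ch_add]
      congr 1
      ext i
      simp [sum_insert ha]
  exact key _

lemma int_W2 {s k : ℕ} (w : ℤ → ℝ) (S : Finset ℤ) :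
    ∫ α in (0 : ℝ)..1, ‖∑ x ∈ S, (w x : ℂ) * e ((x : ℝ) ^ k * α)‖ ^ (2 * s) =
      W2 (Fintype.piFinset (fun _ : Fin s => S)) (fun t => ∏ j, w (t j))
        (fun t => ∑ j, (t j) ^ k) := by
  rw [← parseval_cont]
  congr 1
  ext α
  rw [mul_comm 2 s, pow_mul, ← norm_pow]
  congr 2
  have := Finset.prod_univ_sum (fun _ : Fin s => S) (fun _ (x : ℤ) => (w x : ℂ) * e ((x : ℝ) ^ k * α))
  rw [prod_const, card_univ, Fintype.card_fin] at this
  rw [this]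
  refine sum_congr rfl fun t _ => ?_
  rw [prod_mul_distrib]
  push_cast
  congr 1
  have key : ∀ A : Finset (Fin s), ∏ j ∈ A, e ((t j : ℝ) ^ k * α) =
      e ((∑ j ∈ A, (t j : ℝ) ^ k) * α) := by
    intro A
    induction A using Finset.induction_on with
    | empty => simp [e]
    | insert a A ha ih => rw [prod_insert ha, ih, ← e_add, sum_insert ha, add_mul]
  exact key _

end VM

open MeasureTheory Finset
open scoped Classical

namespace VM

lemma sum_ex (m : ℕ) : 2 * ∑ i : Fin (m + 1), (if (i : ℕ) + 1 = m + 1 then 0 else (i : ℕ) + 1) =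
    m * (m + 1) := by
  rw [Fin.sum_univ_eq_sum_range (fun i => if i + 1 = m + 1 then 0 else i + 1) (m + 1),
    sum_range_succ]
  simp only [if_true, add_zero]
  rw [sum_congr rfl (g := fun i => i + 1) (fun i hi => by
    have := mem_range.1 hi
    rw [if_neg (by omega)])]
  induction m with
  | zero => simp
  | succ m ih => rw [sum_range_succ, mul_add, ih]; ring

lemma rk_eval (k d : ℕ) (i : Fin d) (x : ℤ) :
    (rk k d i).eval x = if (i : ℕ) + 1 = d then x ^ k else x ^ ((i : ℕ) + 1) := by
  unfold rk; split_ifs <;> simp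

lemma drop_bound {k d s P N : ℕ} [NeZero N] (hd : 1 ≤ d) (hP : 1 ≤ P) (w : ℤ → ℝ) (S : Finset ℤ)
    (hw : ∀ x ∈ S, 0 ≤ w x) (hS : ∀ x ∈ S, 1 ≤ x ∧ x ≤ (P : ℤ)) :
    W2 (Fintype.piFinset (fun _ : Fin s => S)) (fun t => ∏ j, w (t j))
        (fun t => ∑ j, (t j) ^ k) ≤
      ((s : ℝ) + 1) ^ d * (P : ℝ) ^ (d * (d - 1) / 2) *
      W2 (Fintype.piFinset (fun _ : Fin s => S)) (fun t => ∏ j, w (t j))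
        (fun t => fun i => ((∑ j, (rk k d i).eval (t j) : ℤ) : ZMod N)) := by
  set T := Fintype.piFinset (fun _ : Fin s => S) with hT
  have hTm : ∀ t ∈ T, ∀ j, t j ∈ S := fun t ht j => Fintype.mem_piFinset.1 ht j
  set W : (Fin s → ℤ) → ℝ := fun t => ∏ j, w (t j) with hW
  have hW0 : ∀ t ∈ T, 0 ≤ W t := fun t ht => prod_nonneg fun j _ => hw _ (hTm t ht j)
  let b : (Fin s → ℤ) → Fin d → ℤ := fun t i => if (i : ℕ) + 1 = d then 0 else ∑ j, (t j) ^ ((i : ℕ) + 1)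
  let M : Finset (Fin d → ℤ) := Fintype.piFinset (fun i : Fin d =>
    Finset.Icc (0 : ℤ) (if (i : ℕ) + 1 = d then 0 else (s : ℤ) * (P : ℤ) ^ ((i : ℕ) + 1)))
  have hM : ∀ t ∈ T, b t ∈ M := by
    intro t ht
    rw [Fintype.mem_piFinset]
    intro i
    simp only [b, Finset.mem_Icc]
    split_ifs
    · simp
    · constructor
      · exact sum_nonneg fun j _ => pow_nonneg (by have := (hS _ (hTm t ht j)).1; omega) _
      · calc ∑ j, (t j) ^ ((i : ℕ) + 1) ≤ ∑ j : Fin s, (P : ℤ) ^ ((i : ℕ) + 1) := by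
              refine sum_le_sum fun j _ => ?_
              have := hS _ (hTm t ht j)
              exact pow_le_pow_left₀ (by omega) this.2 _
          _ = _ := by simp
  have hMc : (M.card : ℝ) ≤ ((s : ℝ) + 1) ^ d * (P : ℝ) ^ (d * (d - 1) / 2) := by
    have h1 : M.card ≤ ∏ i : Fin d, ((s + 1) * P ^ (if (i : ℕ) + 1 = d then 0 else (i : ℕ) + 1)) := by
      rw [Fintype.card_piFinset]
      refine prod_le_prod' fun i _ => ?_
      rw [Int.card_Icc]
      split_ifs
      · simp
      · have : ((s : ℤ) * (P : ℤ) ^ ((i : ℕ) + 1) + 1 - 0).toNat = s * P ^ ((i : ℕ) + 1) + 1 := by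
          rw [sub_zero]; exact_mod_cast Int.toNat_natCast (s * P ^ ((i : ℕ) + 1) + 1)
        rw [this, add_mul, one_mul]
        gcongr
        exact Nat.one_le_pow _ _ hP
    have h2 : ∏ i : Fin d, ((s + 1) * P ^ (if (i : ℕ) + 1 = d then 0 else (i : ℕ) + 1)) =
        (s + 1) ^ d * P ^ (d * (d - 1) / 2) := by
      rw [prod_mul_distrib, prod_const, card_univ, Fintype.card_fin, prod_pow_eq_pow_sum]
      congr 2
      obtain ⟨m, rfl⟩ : ∃ m, d = m + 1 := ⟨d - 1, by omega⟩
      have := sum_ex m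
      rw [Nat.add_sub_cancel, mul_comm (m + 1) m, ← this]
      simp
    rw [h2] at h1
    exact_mod_cast h1
  refine (drop T W _ b M hM).trans ?_
  have h3 : W2 T W (fun t => (∑ j, (t j) ^ k, b t)) ≤
      W2 T W (fun t => fun i => ((∑ j, (rk k d i).eval (t j) : ℤ) : ZMod N)) := by
    refine W2_mono T W hW0 _ _ fun x _ y _ h => ?_
    obtain ⟨h4, h5⟩ := Prod.mk.inj h
    ext i
    congr 1
    simp only [rk_eval]
    by_cases hi : (i : ℕ) + 1 = d
    · simpa only [hi, if_true] using h4
    · have := congrFun h5 i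
      simpa only [b, hi, if_false] using this
  have h0 : 0 ≤ W2 T W (fun t => (∑ j, (t j) ^ k, b t)) := by
    refine sum_nonneg fun x hx => sum_nonneg fun y hy => ?_
    split_ifs
    · exact mul_nonneg (hW0 x hx) (hW0 y hy)
    · rfl
  exact mul_le_mul hMc h3 h0 (by positivity)

theorem mv_bound {p : ℕ} [Fact p.Prime] (h8 : 8 ≤ p) {k d : ℕ} (hd : 1 ≤ d) (hdk : d ≤ k)
    (hkp : k < p) {ε : ℝ} (hε : 0 < ε) :
    ∃ C > (0 : ℝ), ∀ P : ℕ, 1 ≤ P → ∀ (S : Finset ℤ) (w : ℤ → ℝ) (Wm : ℝ), 0 ≤ Wm →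
      (∀ x ∈ S, 0 ≤ w x ∧ w x ≤ Wm) → (∀ x ∈ S, 1 ≤ x ∧ x ≤ (P : ℤ) ∧ ¬ (p : ℤ) ∣ x) →
      ∫ α in (0 : ℝ)..1, ‖∑ x ∈ S, (w x : ℂ) * e ((x : ℝ) ^ k * α)‖ ^ (d * (d + 1)) ≤
        C * (P : ℝ) ^ ((d : ℝ) ^ 2 + ε) * Wm ^ (d * (d + 1)) := by
  obtain ⟨C0, hC0, hA⟩ := adm_all h8 d hd (by omega) ε hε
  have hp : p.Prime := Fact.out
  have hp1 : (1 : ℝ) ≤ p := by exact_mod_cast hp.one_lt.le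
  have hp0 : 0 < p := hp.pos
  set s := d * (d + 1) / 2 with hs
  have h2s : 2 * s = d * (d + 1) := Nat.mul_div_cancel' (Nat.even_mul_succ_self d).two_dvd
  have hs1 : 1 ≤ s := by nlinarith
  refine ⟨((s : ℝ) + 1) ^ d * ((p : ℝ) ^ (d * (d + 1)) * C0), by positivity, ?_⟩
  intro P hP S w Wm hWm hw hS
  set n := Nat.log p P with hn
  have hn1 : p ^ n ≤ P := Nat.pow_log_le_self p (by omega)
  have hn2 : P < p ^ (n + 1) := Nat.lt_pow_succ_log_self hp.one_lt P
  haveI : NeZero (p ^ (d * (n + 1))) := ⟨by positivity⟩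
  set N := p ^ (d * (n + 1)) with hN
  have hNpos : (0 : ℝ) < (N : ℝ) := by rw [hN]; positivity
  have hPr : (1 : ℝ) ≤ P := by exact_mod_cast hP
  rw [← h2s, int_W2]
  refine (drop_bound (d := d) (P := P) (N := N) hd hP w S (fun x hx => (hw x hx).1)
    (fun x hx => ⟨(hS x hx).1, (hS x hx).2.1⟩)).trans ?_
  have hb := disc_bound (k := k) (n := n) hd hdk hkp (K := C0 * (p : ℝ) ^ (ε * n)) (by positivity)
    (hA n) w hWm S hw (fun x hx => ⟨(hS x hx).1, lt_of_le_of_lt (hS x hx).2.1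
      (by exact_mod_cast hn2), (hS x hx).2.2⟩)
  rw [← hs, ← h2s, LN_W2 (s := s)] at hb
  set V := W2 (Fintype.piFinset (fun _ : Fin s => S)) (fun t => ∏ j, w (t j))
        (fun t => fun i => ((∑ j, (rk k d i).eval (t j) : ℤ) : ZMod N)) with hV
  have hVb : V ≤ (p : ℝ) ^ (2 * s) * (C0 * (P : ℝ) ^ ε * (P : ℝ) ^ s * Wm ^ (2 * s)) := by
    have h1 : (N : ℝ) ^ d * V ≤ (N : ℝ) ^ d * ((p : ℝ) ^ (2 * s) *
        (C0 * (p : ℝ) ^ (ε * n) * ((p : ℝ) ^ n) ^ s * Wm ^ (2 * s))) := by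
      refine hb.trans (le_of_eq ?_)
      obtain ⟨u, hu⟩ : ∃ u, s = u + 1 := ⟨s - 1, by omega⟩
      rw [hu, show 2 * (u + 1) - 1 = 2 * u + 1 by omega, show u + 1 - 1 = u by omega,
        pow_mul]
      ring
    refine (le_of_mul_le_mul_left h1 (by positivity)).trans ?_
    have h3 : (p : ℝ) ^ n ≤ P := by exact_mod_cast hn1
    have h4 : (p : ℝ) ^ (ε * n) ≤ (P : ℝ) ^ ε := by
      rw [mul_comm, Real.rpow_mul (by positivity), Real.rpow_natCast]
      exact Real.rpow_le_rpow (by positivity) h3 hε.le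
    gcongr
  calc _ ≤ ((s : ℝ) + 1) ^ d * (P : ℝ) ^ (d * (d - 1) / 2) *
        ((p : ℝ) ^ (2 * s) * (C0 * (P : ℝ) ^ ε * (P : ℝ) ^ s * Wm ^ (2 * s))) := by gcongr
    _ = _ := by
      have h5 : (P : ℝ) ^ ((d : ℝ) ^ 2 + ε) = (P : ℝ) ^ (d * (d - 1) / 2) * (P : ℝ) ^ s * (P : ℝ) ^ ε := by
        rw [Real.rpow_add (by positivity), ← pow_add]
        congr 1
        have : d * (d - 1) / 2 + s = d ^ 2 := by
          have h6 : 2 * (d * (d - 1) / 2) = d * (d - 1) :=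
            Nat.mul_div_cancel' (Nat.even_mul_pred_self d).two_dvd
          obtain ⟨m, rfl⟩ : ∃ m, d = m + 1 := ⟨d - 1, by omega⟩
          simp only [Nat.add_sub_cancel] at h6 ⊢
          nlinarith
        rw [this]; exact_mod_cast Real.rpow_natCast (P : ℝ) (d ^ 2)
      rw [h5]; ring

end VM

open MeasureTheory Finset
open scoped Classical

namespace VM

noncomputable def Hh (τ β : ℝ) : ℝ := τ ^ 2 * (1 + (τ * β) ^ 2)⁻¹

lemma Hh_nonneg (τ β : ℝ) : 0 ≤ Hh τ β := by unfold Hh; positivity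

lemma Hh_cont (τ : ℝ) : Continuous (Hh τ) := by
  unfold Hh
  refine continuous_const.mul (Continuous.inv₀ (by fun_prop) fun β => ?_)
  positivity

lemma Hh_int {τ : ℝ} (hτ : 0 < τ) : Integrable (Hh τ) ∧ ∫ β, Hh τ β = τ * Real.pi := by
  constructor
  · exact (integrable_inv_one_add_sq.comp_mul_left' hτ.ne').const_mul _
  · unfold Hh
    rw [integral_const_mul, Measure.integral_comp_mul_left (fun x => (1 + x ^ 2)⁻¹) τ,
      integral_univ_inv_one_add_sq, abs_of_pos (by positivity), smul_eq_mul]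
    field_simp

lemma Hh_shift {τ : ℝ} (h0 : 0 < τ) (h1 : τ < 1) (β : ℝ) {t : ℝ} (ht : t ∈ Set.Icc (0 : ℝ) 1) :
    Hh τ β ≤ 3 * Hh τ (β + t) := by
  unfold Hh
  have ha : (0 : ℝ) < 1 + (τ * β) ^ 2 := by positivity
  have hb : (0 : ℝ) < 1 + (τ * (β + t)) ^ 2 := by positivity
  have h2 : 1 + (τ * (β + t)) ^ 2 ≤ 3 * (1 + (τ * β) ^ 2) := by
    have h3 : (τ * t) ^ 2 ≤ 1 := by
      have : τ * t ≤ 1 := by nlinarith [ht.1, ht.2]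
      have : 0 ≤ τ * t := mul_nonneg h0.le ht.1
      nlinarith
    have h4 := two_mul_le_add_sq (τ * β) (τ * t)
    rw [mul_add]
    nlinarith
  have h5 : (1 + (τ * β) ^ 2)⁻¹ ≤ 3 * (1 + (τ * (β + t)) ^ 2)⁻¹ := by
    rw [← div_eq_mul_inv, le_div_iff₀ hb, inv_mul_le_iff₀ ha]; linarith
  have := mul_le_mul_of_nonneg_left h5 (sq_nonneg τ)
  linarith

lemma Kf_nonneg (τ α : ℝ) : 0 ≤ Kf τ α := by unfold Kf; split_ifs <;> positivity

lemma Kf_le {τ : ℝ} (h0 : 0 < τ) (lam α : ℝ) : Kf τ α ≤ 2 * (1 + lam ^ 2) * Hh τ (lam * α) := by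
  have ha : (0 : ℝ) < 1 + (τ * α) ^ 2 := by positivity
  have hb : (0 : ℝ) < 1 + (τ * (lam * α)) ^ 2 := by positivity
  have h1 : Kf τ α * (1 + (τ * α) ^ 2) ≤ 2 * τ ^ 2 := by
    unfold Kf
    split_ifs with h
    · subst h; simp; nlinarith [sq_nonneg τ]
    · have hpa : Real.pi * α ≠ 0 := mul_ne_zero Real.pi_ne_zero h
      have e1 : (Real.sin (Real.pi * τ * α) / (Real.pi * α)) ^ 2 ≤ τ ^ 2 := by
        rw [div_pow, div_le_iff₀ (by positivity)]
        have := Real.abs_sin_le_abs (x := Real.pi * τ * α)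
        have := sq_le_sq.2 this
        calc _ ≤ _ := this
          _ = _ := by ring
      have e2 : (Real.sin (Real.pi * τ * α) / (Real.pi * α)) ^ 2 * (τ * α) ^ 2 ≤ τ ^ 2 := by
        have : (Real.sin (Real.pi * τ * α) / (Real.pi * α)) ^ 2 * (τ * α) ^ 2 =
            Real.sin (Real.pi * τ * α) ^ 2 * (τ ^ 2 / Real.pi ^ 2) := by field_simp
        rw [this]
        have h3 : Real.sin (Real.pi * τ * α) ^ 2 ≤ 1 := Real.sin_sq_le_one _
        have h4 : τ ^ 2 / Real.pi ^ 2 ≤ τ ^ 2 :=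
          div_le_self (sq_nonneg _) (by nlinarith [Real.pi_gt_three])
        have h5 : 0 ≤ τ ^ 2 / Real.pi ^ 2 := by positivity
        nlinarith
      linarith
  have h2 : 1 + (τ * (lam * α)) ^ 2 ≤ (1 + lam ^ 2) * (1 + (τ * α) ^ 2) := by
    nlinarith [sq_nonneg lam, sq_nonneg (τ * α)]
  unfold Hh
  rw [← mul_assoc, ← div_eq_mul_inv, le_div_iff₀ hb]
  have hK := Kf_nonneg τ α
  calc Kf τ α * (1 + (τ * (lam * α)) ^ 2) ≤ Kf τ α * ((1 + lam ^ 2) * (1 + (τ * α) ^ 2)) :=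
        mul_le_mul_of_nonneg_left h2 hK
    _ = (1 + lam ^ 2) * (Kf τ α * (1 + (τ * α) ^ 2)) := by ring
    _ ≤ (1 + lam ^ 2) * (2 * τ ^ 2) := by gcongr
    _ = _ := by ring

lemma GH_lint {G : ℝ → ℝ} (hG : Continuous G) (hG0 : ∀ x, 0 ≤ G x) (hper : Function.Periodic G 1)
    {τ : ℝ} (h0 : 0 < τ) (h1 : τ < 1) :
    ∫⁻ β, ENNReal.ofReal (G β * Hh τ β) ≤
      ENNReal.ofReal (3 * (τ * Real.pi) * ∫ t in (0 : ℝ)..1, G t) := by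
  have hHm : Measurable (Hh τ) := (Hh_cont τ).measurable
  have hGm : Measurable G := hG.measurable
  set μ := volume.restrict (Set.Icc (0 : ℝ) 1) with hμ
  have hμ1 : μ Set.univ = 1 := by simp [hμ]
  calc ∫⁻ β, ENNReal.ofReal (G β * Hh τ β)
      ≤ ∫⁻ β, ∫⁻ t, ENNReal.ofReal (3 * (G β * Hh τ (β + t))) ∂μ := by
        refine lintegral_mono fun β => ?_
        calc ENNReal.ofReal (G β * Hh τ β) = ∫⁻ t, ENNReal.ofReal (G β * Hh τ β) ∂μ := by
              rw [lintegral_const, hμ1, mul_one]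
          _ ≤ _ := by
              refine setLIntegral_mono' measurableSet_Icc fun t ht => ?_
              refine ENNReal.ofReal_le_ofReal ?_
              have := mul_le_mul_of_nonneg_left (Hh_shift h0 h1 β ht) (hG0 β)
              linarith
    _ = ∫⁻ t, (∫⁻ β, ENNReal.ofReal (3 * (G β * Hh τ (β + t)))) ∂μ := by
        refine lintegral_lintegral_swap ?_
        refine Measurable.aemeasurable ?_
        simp only [Function.uncurry_def]
        refine ENNReal.measurable_ofReal.comp ?_
        refine measurable_const.mul ((hGm.comp measurable_fst).mul (hHm.comp ?_))
        exact measurable_fst.add measurable_snd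
    _ = ∫⁻ t, (∫⁻ β, ENNReal.ofReal (3 * (G (β - t) * Hh τ β))) ∂μ := by
        refine lintegral_congr fun t => ?_
        have := lintegral_add_right_eq_self (μ := (volume : Measure ℝ))
          (fun β => ENNReal.ofReal (3 * (G (β - t) * Hh τ β))) t
        rw [← this]
        simp
    _ = ∫⁻ β, ∫⁻ t, ENNReal.ofReal (3 * (G (β - t) * Hh τ β)) ∂μ := by
        refine (lintegral_lintegral_swap ?_).symm
        refine Measurable.aemeasurable ?_
        simp only [Function.uncurry_def]
        refine ENNReal.measurable_ofReal.comp ?_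
        refine measurable_const.mul ((hGm.comp ?_).mul (hHm.comp measurable_fst))
        exact measurable_fst.sub measurable_snd
    _ = ∫⁻ β, ENNReal.ofReal (3 * (∫ t in (0 : ℝ)..1, G t)) * ENNReal.ofReal (Hh τ β) := by
        refine lintegral_congr fun β => ?_
        have hI : ∫ t in (0 : ℝ)..1, G t = ∫ t, G (β - t) ∂μ := by
          rw [hμ, integral_Icc_eq_integral_Ioc, ← intervalIntegral.integral_of_le zero_le_one,
            intervalIntegral.integral_comp_sub_left]
          have := hper.intervalIntegral_add_eq 0 (β - 1)
          simpa using this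
        have hint : Integrable (fun t => G (β - t)) μ :=
          (hG.comp (continuous_const.sub continuous_id)).continuousOn.integrableOn_compact isCompact_Icc
        rw [hI, ENNReal.ofReal_mul (by norm_num), mul_assoc,
          ofReal_integral_eq_lintegral_ofReal hint (Filter.Eventually.of_forall fun _ => hG0 _)]
        have : ∀ t, ENNReal.ofReal (3 * (G (β - t) * Hh τ β)) = ENNReal.ofReal 3 *
            (ENNReal.ofReal (G (β - t)) * ENNReal.ofReal (Hh τ β)) := by
          intro t
          rw [ENNReal.ofReal_mul (by norm_num), ENNReal.ofReal_mul (hG0 _)]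
        simp only [this]
        rw [lintegral_const_mul' _ _ ENNReal.ofReal_ne_top,
          lintegral_mul_const' _ _ ENNReal.ofReal_ne_top]
    _ = _ := by
        rw [lintegral_const_mul' _ _ ENNReal.ofReal_ne_top,
          ← ofReal_integral_eq_lintegral_ofReal (Hh_int h0).1
            (Filter.Eventually.of_forall fun _ => Hh_nonneg _ _), (Hh_int h0).2,
          ← ENNReal.ofReal_mul]
        · congr 1; ring
        · have : 0 ≤ ∫ t in (0 : ℝ)..1, G t :=
            intervalIntegral.integral_nonneg zero_le_one fun x _ => hG0 x
          positivity

theorem ker_bound {G : ℝ → ℝ} (hG : Continuous G) (hG0 : ∀ x, 0 ≤ G x)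
    (hper : Function.Periodic G 1) {τ : ℝ} (h0 : 0 < τ) (h1 : τ < 1) {lam : ℝ} (hl : lam ≠ 0) :
    ∫ α, G (lam * α) * Kf τ α ≤
      (2 * (1 + lam ^ 2) * |lam⁻¹| * (3 * Real.pi)) * τ * ∫ t in (0 : ℝ)..1, G t := by
  have hI0 : 0 ≤ ∫ t in (0 : ℝ)..1, G t :=
    intervalIntegral.integral_nonneg zero_le_one fun x _ => hG0 x
  have hc : Continuous (fun β => G β * Hh τ β) := hG.mul (Hh_cont τ)
  have hnn : ∀ β, 0 ≤ G β * Hh τ β := fun β => mul_nonneg (hG0 β) (Hh_nonneg _ _)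
  have hL := GH_lint hG hG0 hper h0 h1
  have hint : Integrable (fun β => G β * Hh τ β) := by
    refine ⟨hc.aestronglyMeasurable, ?_⟩
    rw [hasFiniteIntegral_iff_ofReal (Filter.Eventually.of_forall hnn)]
    exact lt_of_le_of_lt hL ENNReal.ofReal_lt_top
  have hB : ∫ β, G β * Hh τ β ≤ 3 * (τ * Real.pi) * ∫ t in (0 : ℝ)..1, G t := by
    rw [← ofReal_integral_eq_lintegral_ofReal hint (Filter.Eventually.of_forall hnn)] at hL
    refine (ENNReal.ofReal_le_ofReal_iff ?_).1 hL
    have := Real.pi_pos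
    positivity
  calc ∫ α, G (lam * α) * Kf τ α
      ≤ ∫ α, 2 * (1 + lam ^ 2) * (G (lam * α) * Hh τ (lam * α)) := by
        refine integral_mono_of_nonneg
          (Filter.Eventually.of_forall fun α => mul_nonneg (hG0 _) (Kf_nonneg _ _))
          ((hint.comp_mul_left' hl).const_mul _) (Filter.Eventually.of_forall fun α => ?_)
        have := mul_le_mul_of_nonneg_left (Kf_le h0 lam α) (hG0 (lam * α))
        simp only
        linarith
    _ = 2 * (1 + lam ^ 2) * (|lam⁻¹| * ∫ β, G β * Hh τ β) := by
        rw [integral_const_mul, Measure.integral_comp_mul_left (fun x => G x * Hh τ x) lam,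
          smul_eq_mul]
    _ ≤ 2 * (1 + lam ^ 2) * (|lam⁻¹| * (3 * (τ * Real.pi) * ∫ t in (0 : ℝ)..1, G t)) := by
        gcongr
    _ = _ := by ring

end VM

open MeasureTheory Finset
open scoped Classical

namespace VM

lemma SS_cont (η X : ℝ) (k : ℕ) : Continuous (SS η X k) := by
  unfold SS
  refine continuous_finsetSum _ fun p _ => continuous_const.mul (e_cont.comp ?_)
  fun_prop

lemma SS_per (η X : ℝ) (k : ℕ) : Function.Periodic (SS η X k) 1 := by
  intro α
  unfold SS
  refine sum_congr rfl fun p _ => ?_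
  rw [mul_add, e_add, mul_one]
  have := e_int ((p : ℤ) ^ k)
  push_cast at this
  rw [this, mul_one]

lemma SS_moment {k d : ℕ} (hd : 1 ≤ d) (hdk : d ≤ k) {ε : ℝ} (hε : 0 < ε) {η : ℝ} (hη : 0 < η) :
    ∃ C > (0 : ℝ), ∃ X₀ : ℝ, ∀ X ≥ X₀,
      ∫ α in (0 : ℝ)..1, ‖SS η X k α‖ ^ (d * (d + 1)) ≤ C * X ^ ((d : ℝ) ^ 2 / k + ε) := by
  obtain ⟨q, hq1, hq2⟩ := Nat.exists_infinite_primes (k + 8)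
  have : Fact q.Prime := ⟨hq2⟩
  have hk0 : (0 : ℝ) < k := by exact_mod_cast (by omega : 0 < k)
  have hε1 : 0 < k * (ε / 2) := by positivity
  obtain ⟨C, hC, hB⟩ := mv_bound (p := q) (by omega) hd hdk (by omega) hε1
  have hQ : (0 : ℝ) < ((d * (d + 1) : ℕ) : ℝ) := by exact_mod_cast (by positivity)
  set δ := ε / 2 / ((d * (d + 1) : ℕ) : ℝ) with hδ
  have hδ0 : 0 < δ := by positivity
  refine ⟨C * (1 / δ) ^ (d * (d + 1)), by positivity, max 1 (((q : ℝ) + 1) ^ k / η), fun X hX => ?_⟩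
  have hX1 : 1 ≤ X := (le_max_left _ _).trans hX
  have hX2 : ((q : ℝ) + 1) ^ k / η ≤ X := (le_max_right _ _).trans hX
  have hX0 : 0 < X := by linarith
  have hY1 : 1 ≤ X ^ ((1 : ℝ) / k) := Real.one_le_rpow hX1 (by positivity)
  have hYX : X ^ ((1 : ℝ) / k) ≤ X := by
    calc X ^ ((1 : ℝ) / k) ≤ X ^ (1 : ℝ) := by
          refine Real.rpow_le_rpow_of_exponent_le hX1 ?_
          rw [div_le_one hk0]; exact_mod_cast (by omega : 1 ≤ k)
      _ = X := Real.rpow_one X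
  have hqY : (q : ℝ) + 1 ≤ (η * X) ^ ((1 : ℝ) / k) := by
    rw [div_le_iff₀ hη, mul_comm] at hX2
    calc (q : ℝ) + 1 = (((q : ℝ) + 1) ^ k) ^ ((1 : ℝ) / k) := by
          rw [one_div, Real.pow_rpow_inv_natCast (by positivity) (by omega)]
      _ ≤ _ := Real.rpow_le_rpow (by positivity) hX2 (by positivity)
  set P := ⌊X ^ ((1 : ℝ) / k)⌋₊ with hP
  have hP1 : 1 ≤ P := Nat.le_floor (by exact_mod_cast hY1)
  have hPY : (P : ℝ) ≤ X ^ ((1 : ℝ) / k) := Nat.floor_le (by positivity)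
  set F := (Finset.Icc 1 P).filter
      (fun p : ℕ => p.Prime ∧ (η * X) ^ ((1:ℝ)/(k:ℝ)) ≤ (p : ℝ)) with hF
  have hSS : ∀ α, SS η X k α = ∑ x ∈ F.map Nat.castEmbedding,
      ((Real.log (x : ℤ) : ℝ) : ℂ) * e (((x : ℤ) : ℝ) ^ k * α) := by
    intro α
    rw [sum_map]
    unfold SS
    refine sum_congr rfl fun p _ => ?_
    simp
  have hlog : 0 ≤ Real.log X := Real.log_nonneg hX1
  have hF2 : ∀ p ∈ F, 1 ≤ p ∧ p ≤ P ∧ p.Prime ∧ (q : ℝ) + 1 ≤ p := by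
    intro p hp
    obtain ⟨h1, h2, h3⟩ := mem_filter.1 hp
    obtain ⟨h4, h5⟩ := Finset.mem_Icc.1 h1
    exact ⟨h4, h5, h2, hqY.trans h3⟩
  have hmain := hB P hP1 (F.map Nat.castEmbedding) (fun x => Real.log (x : ℤ)) (Real.log X) hlog
    (by
      intro x hx
      obtain ⟨p, hp, rfl⟩ := mem_map.1 hx
      obtain ⟨h1, h2, h3, h4⟩ := hF2 p hp
      have h1' : (1 : ℝ) ≤ p := by exact_mod_cast h1
      have h2' : (p : ℝ) ≤ X := le_trans (by exact_mod_cast h2) (hPY.trans hYX)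
      simp only [Nat.castEmbedding_apply, Int.cast_natCast]
      exact ⟨Real.log_nonneg h1', Real.log_le_log (by linarith) h2'⟩)
    (by
      intro x hx
      obtain ⟨p, hp, rfl⟩ := mem_map.1 hx
      obtain ⟨h1, h2, h3, h4⟩ := hF2 p hp
      simp only [Nat.castEmbedding_apply]
      refine ⟨by exact_mod_cast h1, by exact_mod_cast h2, fun h => ?_⟩
      have h5 : q ∣ p := by exact_mod_cast h
      have h6 : q = p := (Nat.prime_dvd_prime_iff_eq hq2 h3).1 h5
      rw [h6] at h4; linarith)
  simp only [← hSS] at hmain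
  refine hmain.trans ?_
  have e1 : (P : ℝ) ^ ((d : ℝ) ^ 2 + k * (ε / 2)) ≤ X ^ ((d : ℝ) ^ 2 / k + ε / 2) := by
    calc (P : ℝ) ^ ((d : ℝ) ^ 2 + k * (ε / 2)) ≤
          (X ^ ((1 : ℝ) / k)) ^ ((d : ℝ) ^ 2 + k * (ε / 2)) :=
          Real.rpow_le_rpow (by positivity) hPY (by positivity)
      _ = _ := by
          rw [← Real.rpow_mul hX0.le]
          congr 1
          field_simp
  have e2 : Real.log X ^ (d * (d + 1)) ≤ (1 / δ) ^ (d * (d + 1)) * X ^ (ε / 2) := by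
    have h1 : Real.log X ≤ (1 / δ) * X ^ δ := by
      have := Real.log_le_rpow_div hX0.le hδ0
      calc _ ≤ _ := this
        _ = _ := by ring
    calc Real.log X ^ (d * (d + 1)) ≤ ((1 / δ) * X ^ δ) ^ (d * (d + 1)) := by gcongr
      _ = _ := by
          rw [mul_pow, ← Real.rpow_mul_natCast hX0.le]
          congr 2
          rw [hδ]; field_simp
  calc C * (P : ℝ) ^ ((d : ℝ) ^ 2 + k * (ε / 2)) * Real.log X ^ (d * (d + 1)) ≤
      C * X ^ ((d : ℝ) ^ 2 / k + ε / 2) * ((1 / δ) ^ (d * (d + 1)) * X ^ (ε / 2)) := by gcongr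
    _ = C * (1 / δ) ^ (d * (d + 1)) * (X ^ ((d : ℝ) ^ 2 / k + ε / 2) * X ^ (ε / 2)) := by ring
    _ = _ := by rw [← Real.rpow_add hX0]; congr 2; ring

lemma interp {y A B θ q1 q2 : ℝ} (hy : 0 ≤ y) (hA : 0 < A) (hB : 0 < B) (h0 : 0 ≤ θ) (h1 : θ ≤ 1)
    (hAB : A ^ (1 - θ) * B ^ θ = 1) (hq1 : 0 ≤ q1) (hq2 : 0 ≤ q2) :
    y ^ ((1 - θ) * q1 + θ * q2) ≤ (1 - θ) * (A * y ^ q1) + θ * (B * y ^ q2) := by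
  have h := Real.geom_mean_le_arith_mean2_weighted (w₁ := 1 - θ) (w₂ := θ) (p₁ := A * y ^ q1)
    (p₂ := B * y ^ q2) (by linarith) h0 (by positivity) (by positivity) (by ring)
  refine le_trans (le_of_eq ?_) h
  rw [Real.mul_rpow hA.le (by positivity), Real.mul_rpow hB.le (by positivity),
    ← Real.rpow_mul hy, ← Real.rpow_mul hy,
    Real.rpow_add_of_nonneg hy (mul_nonneg (by linarith) hq1) (mul_nonneg h0 hq2),
    mul_comm (1 - θ) q1, mul_comm θ q2]
  calc _ = (A ^ (1 - θ) * B ^ θ) * (y ^ (q1 * (1 - θ)) * y ^ (q2 * θ)) := by rw [hAB, one_mul]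
    _ = _ := by ring

lemma SS_moment_interp {k d : ℕ} (hd : 1 ≤ d) (hdk : d + 1 ≤ k) {θ : ℝ} (h0 : 0 ≤ θ) (h1 : θ ≤ 1)
    {ε : ℝ} (hε : 0 < ε) {η : ℝ} (hη : 0 < η) :
    ∃ C > (0 : ℝ), ∃ X₀ ≥ (1 : ℝ), ∀ X ≥ X₀,
      ∫ α in (0 : ℝ)..1, ‖SS η X k α‖ ^ ((d : ℝ) * (d + 1) + 2 * (d + 1) * θ) ≤
        C * X ^ (((d : ℝ) * (d + 1) + 2 * (d + 1) * θ - (d + θ)) / k + ε) := by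
  obtain ⟨C1, hC1, X1, hX1⟩ := SS_moment (k := k) hd (by omega) hε hη
  obtain ⟨C2, hC2, X2, hX2⟩ := SS_moment (k := k) (d := d + 1) (by omega) (by omega) hε hη
  refine ⟨(1 - θ) * C1 + θ * C2, ?_, max 1 (max X1 X2), le_max_left _ _, fun X hX => ?_⟩
  · rcases h0.eq_or_lt with h | h
    · subst h; simpa using hC1
    · have : 0 ≤ 1 - θ := by linarith
      positivity
  have hXge1 : 1 ≤ X := (le_max_left _ _).trans hX
  have hXpos : 0 < X := by linarith
  have hI1 := hX1 X (((le_max_left _ _).trans (le_max_right _ _)).trans hX)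
  have hI2 := hX2 X (((le_max_right _ _).trans (le_max_right _ _)).trans hX)
  have hk0 : (0 : ℝ) < k := by exact_mod_cast (by omega : 0 < k)
  set E : ℝ := (1 - θ) * (d : ℝ) ^ 2 + θ * ((d : ℝ) + 1) ^ 2 with hE
  have hE2 : (d : ℝ) * (d + 1) + 2 * (d + 1) * θ - (d + θ) = E := by rw [hE]; ring
  rw [hE2]
  set A := X ^ ((E - (d : ℝ) ^ 2) / k) with hA
  set B := X ^ ((E - ((d : ℝ) + 1) ^ 2) / k) with hB
  have hApos : 0 < A := by positivity
  have hBpos : 0 < B := by positivity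
  have hAB : A ^ (1 - θ) * B ^ θ = 1 := by
    rw [hA, hB, ← Real.rpow_mul hXpos.le, ← Real.rpow_mul hXpos.le, ← Real.rpow_add hXpos]
    rw [show (E - (d : ℝ) ^ 2) / k * (1 - θ) + (E - ((d : ℝ) + 1) ^ 2) / k * θ = 0 by
      rw [hE]; field_simp; ring, Real.rpow_zero]
  have hpt : ∀ α, ‖SS η X k α‖ ^ ((d : ℝ) * (d + 1) + 2 * (d + 1) * θ) ≤
      (1 - θ) * A * ‖SS η X k α‖ ^ (d * (d + 1)) +
      θ * B * ‖SS η X k α‖ ^ ((d + 1) * (d + 1 + 1)) := by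
    intro α
    have h := interp (y := ‖SS η X k α‖) (q1 := ((d * (d + 1) : ℕ) : ℝ))
      (q2 := (((d + 1) * (d + 1 + 1) : ℕ) : ℝ)) (norm_nonneg _) hApos hBpos h0 h1 hAB
      (Nat.cast_nonneg _) (Nat.cast_nonneg _)
    rw [Real.rpow_natCast, Real.rpow_natCast] at h
    have h3 : (1 - θ) * ((d * (d + 1) : ℕ) : ℝ) + θ * (((d + 1) * (d + 1 + 1) : ℕ) : ℝ) =
        (d : ℝ) * (d + 1) + 2 * (d + 1) * θ := by push_cast; ring
    rw [h3] at h
    linarith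
  have hc := SS_cont η X k
  have hc1 : ∀ m : ℕ, Continuous fun α => ‖SS η X k α‖ ^ m := fun m => hc.norm.pow m
  have hcm : Continuous fun α => ‖SS η X k α‖ ^ ((d : ℝ) * (d + 1) + 2 * (d + 1) * θ) :=
    hc.norm.rpow_const fun _ => Or.inr (by positivity)
  have hc2 : Continuous fun α => (1 - θ) * A * ‖SS η X k α‖ ^ (d * (d + 1)) := continuous_const.mul (hc1 _)
  have hc3 : Continuous fun α => θ * B * ‖SS η X k α‖ ^ ((d + 1) * (d + 1 + 1)) :=
    continuous_const.mul (hc1 _)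
  have hθ : 0 ≤ 1 - θ := by linarith
  calc _ ≤ ∫ α in (0 : ℝ)..1, ((1 - θ) * A * ‖SS η X k α‖ ^ (d * (d + 1)) +
      θ * B * ‖SS η X k α‖ ^ ((d + 1) * (d + 1 + 1))) :=
        intervalIntegral.integral_mono_on zero_le_one (hcm.intervalIntegrable _ _)
          ((hc2.add hc3).intervalIntegrable _ _) fun α _ => hpt α
    _ = (1 - θ) * A * (∫ α in (0 : ℝ)..1, ‖SS η X k α‖ ^ (d * (d + 1))) +
      θ * B * ∫ α in (0 : ℝ)..1, ‖SS η X k α‖ ^ ((d + 1) * (d + 1 + 1)) := by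
        rw [intervalIntegral.integral_add (hc2.intervalIntegrable _ _) (hc3.intervalIntegrable _ _),
          intervalIntegral.integral_const_mul, intervalIntegral.integral_const_mul]
    _ ≤ (1 - θ) * A * (C1 * X ^ ((d : ℝ) ^ 2 / k + ε)) +
      θ * B * (C2 * X ^ (((d + 1 : ℕ) : ℝ) ^ 2 / k + ε)) := by gcongr
    _ = (1 - θ) * C1 * (A * X ^ ((d : ℝ) ^ 2 / k + ε)) +
      θ * C2 * (B * X ^ (((d + 1 : ℕ) : ℝ) ^ 2 / k + ε)) := by ring
    _ = _ := by
        rw [hA, hB, ← Real.rpow_add hXpos, ← Real.rpow_add hXpos, add_mul]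
        congr 3
        · ring
        · push_cast; ring

lemma m1_form (k : ℕ) (hk : 5 ≤ k) : ∃ (d : ℕ) (θ : ℝ), 1 ≤ d ∧ d + 1 ≤ k ∧ 0 ≤ θ ∧ θ ≤ 1 ∧
    m1 k = (d : ℝ) * (d + 1) + 2 * (d + 1) * θ ∧ 49 * (k : ℝ) / 50 ≤ d + θ := by
  by_cases h5 : k = 5
  · subst h5
    refine ⟨4, 1, by norm_num, by norm_num, by norm_num, by norm_num, ?_, by norm_num⟩
    have : ⌈(343 * ((5 : ℕ) : ℝ) / 50 - 20)⌉ = 15 := by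
      rw [Int.ceil_eq_iff]; norm_num
    unfold m1
    rw [if_pos rfl, this]; norm_num
  · have hkr : (5 : ℝ) ≤ k := by exact_mod_cast hk
    set x : ℝ := 49 * (k : ℝ) / 50 with hx
    obtain ⟨d, hd⟩ : ∃ d : ℕ, ⌊x⌋ = (d : ℤ) :=
      Int.eq_ofNat_of_zero_le (Int.floor_nonneg.2 (by positivity))
    have hdr : ((⌊x⌋ : ℤ) : ℝ) = d := by rw [hd]; simp
    have h1 : (d : ℝ) ≤ x := hdr ▸ Int.floor_le x
    have h2 : x < d + 1 := hdr ▸ Int.lt_floor_add_one x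
    have hm : m1 k = 2 * (⌈(x - (d : ℝ) / 2) * ((d : ℝ) + 1)⌉ : ℝ) := by
      unfold m1
      rw [if_neg h5, ← hx, hdr]
    set c : ℤ := ⌈(x - (d : ℝ) / 2) * ((d : ℝ) + 1)⌉ with hc
    have hc1 : (x - (d : ℝ) / 2) * ((d : ℝ) + 1) ≤ c := Int.le_ceil _
    obtain ⟨u, hu⟩ := (Nat.even_mul_succ_self (d + 1))
    have hur : ((d : ℝ) + 1) * (d + 2) = u + u := by
      have : (((d + 1) * (d + 1 + 1) : ℕ) : ℝ) = ((u + u : ℕ) : ℝ) := by rw [← Nat.succ_eq_add_one (d + 1), hu]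
      push_cast at this; linarith
    have hc2 : (c : ℝ) ≤ u := by
      have : c ≤ (u : ℤ) := by
        rw [hc, Int.ceil_le]
        push_cast
        have : (0 : ℝ) ≤ d := Nat.cast_nonneg _
        nlinarith
      exact_mod_cast this
    have hdp : (0 : ℝ) < 2 * ((d : ℝ) + 1) := by positivity
    refine ⟨d, (2 * c - d * (d + 1)) / (2 * (d + 1)), ?_, ?_, ?_, ?_, ?_, ?_⟩
    · have : (0 : ℝ) < d := by linarith
      exact_mod_cast this
    · have : (d : ℝ) < k := by linarith
      exact_mod_cast this
    · apply div_nonneg _ hdp.le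
      nlinarith
    · rw [div_le_one hdp]; nlinarith
    · rw [hm]; field_simp; ring
    · have : x - d ≤ (2 * c - d * (d + 1)) / (2 * (d + 1)) := by
        rw [le_div_iff₀ hdp]; nlinarith
      linarith

theorem final (k : ℕ) (hk : 5 ≤ k) (lam : ℝ) (hlam : lam ≠ 0)
    (ε : ℝ) (hε : 0 < ε) (η : ℝ) (hη : 0 < η) :
    ∃ C > (0:ℝ), ∃ X₀ : ℝ, ∀ X ≥ X₀, ∀ τ : ℝ, 0 < τ → τ < 1 →
      (∫ α : ℝ, ‖SS η X k (lam * α)‖ ^ (m1 k) * Kf τ α)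
        ≤ C * τ * X ^ (m1 k / (k:ℝ) - 49/50 + ε) := by
  obtain ⟨d, θ, hd, hdk, h0, h1, hm, hs⟩ := m1_form k hk
  obtain ⟨C, hC, X₀, hX₀, hB⟩ := SS_moment_interp hd hdk h0 h1 hε hη
  rw [← hm] at hB
  have hm0 : 0 ≤ m1 k := by rw [hm]; positivity
  have hk0 : (0 : ℝ) < k := by exact_mod_cast (by omega : 0 < k)
  have hpi := Real.pi_pos
  have hlam' : 0 < |lam⁻¹| := abs_pos.2 (inv_ne_zero hlam)
  refine ⟨(2 * (1 + lam ^ 2) * |lam⁻¹| * (3 * Real.pi)) * C, by positivity, X₀, ?_⟩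
  intro X hX τ hτ hτ1
  have hX1 : 1 ≤ X := hX₀.trans hX
  have hker := ker_bound (G := fun α => ‖SS η X k α‖ ^ (m1 k))
    ((SS_cont η X k).norm.rpow_const fun _ => Or.inr hm0)
    (fun x => by positivity) (fun x => by simp only [SS_per η X k x]) hτ hτ1 hlam
  refine hker.trans ?_
  have h2 : X ^ ((m1 k - (d + θ)) / k + ε) ≤ X ^ (m1 k / (k:ℝ) - 49/50 + ε) := by
    refine Real.rpow_le_rpow_of_exponent_le hX1 ?_
    have : 49 / 50 ≤ (d + θ) / k := by rw [le_div_iff₀ hk0]; linarith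
    rw [sub_div]; linarith
  calc _ ≤ (2 * (1 + lam ^ 2) * |lam⁻¹| * (3 * Real.pi)) * τ *
        (C * X ^ (m1 k / (k:ℝ) - 49/50 + ε)) := by
        refine mul_le_mul_of_nonneg_left ((hB X hX).trans ?_) (by positivity)
        gcongr
    _ = _ := by ring

end VM

/-- moment estimate for `S_k` with exponent `m₁(k)`. -/
theorem Sk_moment_bound_m1 (k : ℕ) (hk : 5 ≤ k) (lam : ℝ) (hlam : lam ≠ 0)
    (ε : ℝ) (hε : 0 < ε) (η : ℝ) (hη : 0 < η) (hη1 : η < 1) :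
    ∃ C > (0:ℝ), ∃ X₀ : ℝ, ∀ X ≥ X₀, ∀ τ : ℝ, 0 < τ → τ < 1 →
      (∫ α : ℝ, ‖SS η X k (lam * α)‖ ^ (m1 k) * Kf τ α)
        ≤ C * τ * X ^ (m1 k / (k:ℝ) - 49/50 + ε) := by
  exact VM.final k hk lam hlam ε hε η hη
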